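/- Let n_c > 0, k > 0, κ := k√n_c, and let n₀, σ₀ : ℝ³ → ℝ be smooth with n₀ − n_c and σ₀ compactly supported, n₀ ≥ n_c and σ₀ ≥ 0. Set q₀ := k²n₀ + ik σ₀ and γ₀ := q₀/κ². Let Ω ⊂ ℝ³ be a bounded open set, let ρ, ρ⊥ be orthonormal vectors in ℝ³, and let a⃗, b⃗ ∈ ℂ³. Then there exists a constant C > 0, independent of τ, such that for every τ > 0, with ζ := −iτρ + (τ²+κ²)^{1/2}ρ⊥ and η_ζ := (1/|ζ|)(−(ζ·a⃗)ζ − κ ζ×b⃗ + k²a⃗), there exists a twice continuously differentiable function R_ζ : Ω → ℂ³ with sup_Ω|R_ζ| ≤ C such that the field E(x) := γ₀(x)^{−1/2} e^{iζ·x}(η_ζ + R_ζ(x)) satisfies −∇×(∇×E) + q₀E = 0 in Ω. -/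

import Mathlib

open scoped BigOperators

/-- Partial derivative (in direction `i`) of a complex-valued function on `ℝ³`. -/
noncomputable def pdC (f : (Fin 3 → ℝ) → ℂ) (i : Fin 3) (x : Fin 3 → ℝ) : ℂ :=
  fderiv ℝ f x (Pi.single i 1)

/-- Curl of a `ℂ³`-valued field on `ℝ³`. -/
noncomputable def curlC (E : (Fin 3 → ℝ) → Fin 3 → ℂ) (x : Fin 3 → ℝ) : Fin 3 → ℂ :=
  ![pdC (fun y => E y 2) 1 x - pdC (fun y => E y 1) 2 x,
    pdC (fun y => E y 0) 2 x - pdC (fun y => E y 2) 0 x,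
    pdC (fun y => E y 1) 0 x - pdC (fun y => E y 0) 1 x]

/-- Componentwise cross product of complex 3-vectors. -/
noncomputable def crossC (v w : Fin 3 → ℂ) : Fin 3 → ℂ :=
  ![v 1 * w 2 - v 2 * w 1, v 2 * w 0 - v 0 * w 2, v 0 * w 1 - v 1 * w 0]

/-- The complex phase vector `ζ = −iτρ + √(τ²+κ²) ρ⊥`. -/
noncomputable def mxZeta (τ κ : ℝ) (ρ ρp : Fin 3 → ℝ) : Fin 3 → ℂ :=
  fun i => -Complex.I * (τ : ℂ) * (ρ i : ℂ) + ((Real.sqrt (τ ^ 2 + κ ^ 2) : ℝ) : ℂ) * (ρp i : ℂ)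

/-- The polarization `η_ζ = (1/|ζ|)(−(ζ·a)ζ − κ ζ×b + k²a)`. -/
noncomputable def mxEta (k κ : ℝ) (ζ a b : Fin 3 → ℂ) : Fin 3 → ℂ :=
  fun i => (1 / ((Real.sqrt (∑ j, ‖ζ j‖ ^ 2) : ℝ) : ℂ))
    * (-(∑ j, ζ j * a j) * ζ i - (κ : ℂ) * crossC ζ b i + (k : ℂ) ^ 2 * a i)

/-- The CGO field `E(x) = γ₀(x)^{−1/2} e^{iζ·x}(η + R(x))`, with the principal branch
of the complex power. -/
noncomputable def mxE (γ₀ : (Fin 3 → ℝ) → ℂ) (ζ η : Fin 3 → ℂ)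
    (R : (Fin 3 → ℝ) → Fin 3 → ℂ) : (Fin 3 → ℝ) → Fin 3 → ℂ :=
  fun x i => γ₀ x ^ (-(1 / 2) : ℂ)
    * Complex.exp (Complex.I * ∑ j, ζ j * (x j : ℂ)) * (η i + R x i)


/-- weight on the lattice -/
noncomputable def cgoWt (n : Fin 3 → ℤ) : ℝ := 1 + ‖n‖

theorem cgoWt_one_le (n : Fin 3 → ℤ) : 1 ≤ cgoWt n := by
  unfold cgoWt; linarith [norm_nonneg n]

theorem cgoWt_pos (n : Fin 3 → ℤ) : 0 < cgoWt n := lt_of_lt_of_le one_pos (cgoWt_one_le n)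

theorem cgoWt_add (m n : Fin 3 → ℤ) : cgoWt (m + n) ≤ cgoWt m * cgoWt n := by
  unfold cgoWt
  nlinarith [norm_nonneg n, norm_nonneg m, norm_add_le m n, mul_nonneg (norm_nonneg m) (norm_nonneg n)]

/-- rapidly decaying coefficients -/
def cgoRD (c : (Fin 3 → ℤ) → ℂ) : Prop := ∀ N : ℕ, Summable fun n => cgoWt n ^ N * ‖c n‖

theorem cgoRD.summable_norm {c : (Fin 3 → ℤ) → ℂ} (h : cgoRD c) : Summable fun n => ‖c n‖ := by
  simpa using h 0

theorem cgoRD.of_le {c d : (Fin 3 → ℤ) → ℂ} (h : cgoRD c) (K : ℝ) (k : ℕ)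
    (hd : ∀ n, ‖d n‖ ≤ K * cgoWt n ^ k * ‖c n‖) : cgoRD d := by
  intro N
  refine Summable.of_nonneg_of_le (fun n => ?_) (fun n => ?_) ((h (N + k)).mul_left K)
  · have := cgoWt_pos n; positivity
  · have := cgoWt_pos n
    calc cgoWt n ^ N * ‖d n‖ ≤ cgoWt n ^ N * (K * cgoWt n ^ k * ‖c n‖) := by gcongr; exact hd n
      _ = K * (cgoWt n ^ (N + k) * ‖c n‖) := by ring

theorem cgoRD.add {c d : (Fin 3 → ℤ) → ℂ} (hc : cgoRD c) (hd : cgoRD d) :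
    cgoRD fun n => c n + d n := by
  intro N
  refine Summable.of_nonneg_of_le (fun n => ?_) (fun n => ?_) ((hc N).add (hd N))
  · have := cgoWt_pos n; positivity
  · have := cgoWt_pos n
    rw [← mul_add]
    gcongr
    exact norm_add_le _ _

theorem cgoRD.const_mul {c : (Fin 3 → ℤ) → ℂ} (hc : cgoRD c) (z : ℂ) :
    cgoRD fun n => z * c n :=
  hc.of_le ‖z‖ 0 fun n => by simp

/-- the plane wave -/
noncomputable def cgoChr (ξ x : Fin 3 → ℝ) : ℂ := Complex.exp (Complex.I * ((∑ j, ξ j * x j : ℝ) : ℂ))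

theorem cgoChr_norm (ξ x : Fin 3 → ℝ) : ‖cgoChr ξ x‖ = 1 := by
  unfold cgoChr
  rw [mul_comm, Complex.norm_exp_ofReal_mul_I]

theorem cgoChr_add (ξ η x : Fin 3 → ℝ) : cgoChr (fun j => ξ j + η j) x = cgoChr ξ x * cgoChr η x := by
  unfold cgoChr
  rw [← Complex.exp_add, ← mul_add, ← Complex.ofReal_add, ← Finset.sum_add_distrib]
  simp only [add_mul]

/-- frequencies -/
noncomputable def cgoFr (e : Fin 3 → Fin 3 → ℝ) (ω : ℝ) (θ : Fin 3 → ℝ) (n : Fin 3 → ℤ) : Fin 3 → ℝ :=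
  fun j => ω * ∑ i, ((n i : ℝ) + θ i) * e i j

/-- synthesis -/
noncomputable def cgoS (ξ : (Fin 3 → ℤ) → Fin 3 → ℝ) (c : (Fin 3 → ℤ) → ℂ) (x : Fin 3 → ℝ) : ℂ :=
  ∑' n, c n * cgoChr (ξ n) x

/-- polynomially bounded frequencies -/
def cgoPB (ξ : (Fin 3 → ℤ) → Fin 3 → ℝ) : Prop := ∃ K : ℝ, 0 ≤ K ∧ ∀ n j, |ξ n j| ≤ K * cgoWt n

theorem cgoFr_PB (e : Fin 3 → Fin 3 → ℝ) (ω : ℝ) (θ : Fin 3 → ℝ) : cgoPB (cgoFr e ω θ) := by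
  refine ⟨|ω| * ∑ i, ∑ j, (1 + |θ i|) * |e i j|, by positivity, fun n j => ?_⟩
  unfold cgoFr
  rw [abs_mul, mul_assoc]
  gcongr
  rw [Finset.sum_mul]
  refine (Finset.abs_sum_le_sum_abs _ _).trans (Finset.sum_le_sum fun i _ => ?_)
  rw [abs_mul]
  have h1 : |(n i : ℝ) + θ i| ≤ (1 + |θ i|) * cgoWt n := by
    have h2 : |(n i : ℝ)| ≤ ‖n‖ := by
      have := norm_le_pi_norm n i
      rwa [Int.norm_eq_abs] at this
    have := abs_add_le (n i : ℝ) (θ i)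
    unfold cgoWt
    nlinarith [abs_nonneg (θ i), norm_nonneg n, mul_nonneg (abs_nonneg (θ i)) (norm_nonneg n)]
  calc |(n i : ℝ) + θ i| * |e i j| ≤ (1 + |θ i|) * cgoWt n * |e i j| := by gcongr
    _ = (1 + |θ i|) * |e i j| * cgoWt n := by ring
    _ ≤ (∑ j, (1 + |θ i|) * |e i j|) * cgoWt n := by
      have := cgoWt_pos n
      gcongr
      exact Finset.single_le_sum (f := fun j => (1 + |θ i|) * |e i j|) (fun j _ => by positivity) (Finset.mem_univ j)

theorem cgoS_summable {ξ : (Fin 3 → ℤ) → Fin 3 → ℝ} {c : (Fin 3 → ℤ) → ℂ}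
    (hc : Summable fun n => ‖c n‖) (x : Fin 3 → ℝ) : Summable fun n => c n * cgoChr (ξ n) x := by
  refine Summable.of_norm ?_
  simpa [cgoChr_norm] using hc

theorem cgoS_norm_le {ξ : (Fin 3 → ℤ) → Fin 3 → ℝ} {c : (Fin 3 → ℤ) → ℂ}
    (hc : Summable fun n => ‖c n‖) (x : Fin 3 → ℝ) : ‖cgoS ξ c x‖ ≤ ∑' n, ‖c n‖ := by
  refine (norm_tsum_le_tsum_norm ?_).trans_eq ?_ <;> simp [cgoChr_norm, hc]

theorem cgoS_add {ξ : (Fin 3 → ℤ) → Fin 3 → ℝ} {c d : (Fin 3 → ℤ) → ℂ}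
    (hc : cgoRD c) (hd : cgoRD d) (x : Fin 3 → ℝ) :
    cgoS ξ (fun n => c n + d n) x = cgoS ξ c x + cgoS ξ d x := by
  unfold cgoS
  rw [← (cgoS_summable hc.summable_norm x).tsum_add (cgoS_summable hd.summable_norm x)]
  simp only [add_mul]

theorem cgoS_const_mul {ξ : (Fin 3 → ℤ) → Fin 3 → ℝ} {c : (Fin 3 → ℤ) → ℂ} (z : ℂ) (x : Fin 3 → ℝ) :
    cgoS ξ (fun n => z * c n) x = z * cgoS ξ c x := by
  unfold cgoS
  rw [← tsum_mul_left]
  simp only [mul_assoc]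

/-- derivative coefficients -/
noncomputable def cgoD (ξ : (Fin 3 → ℤ) → Fin 3 → ℝ) (j : Fin 3) (c : (Fin 3 → ℤ) → ℂ) :
    (Fin 3 → ℤ) → ℂ := fun n => Complex.I * (ξ n j : ℂ) * c n

theorem cgoRD.D {ξ : (Fin 3 → ℤ) → Fin 3 → ℝ} (hξ : cgoPB ξ) {c : (Fin 3 → ℤ) → ℂ} (hc : cgoRD c)
    (j : Fin 3) : cgoRD (cgoD ξ j c) := by
  obtain ⟨K, hK, h⟩ := hξ
  refine hc.of_le K 1 fun n => ?_
  simp only [cgoD, norm_mul, Complex.norm_I, one_mul, Complex.norm_real, pow_one, Real.norm_eq_abs]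
  gcongr
  exact h n j

theorem cgoChr_hasFDerivAt (ξ x : Fin 3 → ℝ) :
    HasFDerivAt (cgoChr ξ) (∑ j, (Complex.I * (ξ j : ℂ) * cgoChr ξ x) •
      (Complex.ofRealCLM.comp (ContinuousLinearMap.proj j : (Fin 3 → ℝ) →L[ℝ] ℝ))) x := by
  have h1 : HasFDerivAt (fun x : Fin 3 → ℝ => Complex.I * ((∑ j, ξ j * x j : ℝ) : ℂ))
      (∑ j, (Complex.I * (ξ j : ℂ)) •
      (Complex.ofRealCLM.comp (ContinuousLinearMap.proj j : (Fin 3 → ℝ) →L[ℝ] ℝ))) x := by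
    have := (∑ j, (Complex.I * (ξ j : ℂ)) •
      (Complex.ofRealCLM.comp (ContinuousLinearMap.proj j : (Fin 3 → ℝ) →L[ℝ] ℝ))).hasFDerivAt (x := x)
    convert this using 1
    ext y
    simp [Finset.mul_sum, mul_assoc]
  have := h1.cexp
  unfold cgoChr
  refine this.congr_fderiv ?_
  rw [Finset.smul_sum]
  refine Finset.sum_congr rfl fun j _ => ?_
  rw [smul_smul]
  congr 1
  ring

theorem cgoS_hasFDerivAt {ξ : (Fin 3 → ℤ) → Fin 3 → ℝ} (hξ : cgoPB ξ) {c : (Fin 3 → ℤ) → ℂ} (hc : cgoRD c)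
    (x : Fin 3 → ℝ) :
    HasFDerivAt (cgoS ξ c) (∑ j, cgoS ξ (cgoD ξ j c) x •
      (Complex.ofRealCLM.comp (ContinuousLinearMap.proj j : (Fin 3 → ℝ) →L[ℝ] ℝ))) x := by
  set P : Fin 3 → ((Fin 3 → ℝ) →L[ℝ] ℂ) := fun j =>
    (Complex.ofRealCLM.comp (ContinuousLinearMap.proj j : (Fin 3 → ℝ) →L[ℝ] ℝ)) with hP
  have hu : Summable fun n => ∑ j, ‖cgoD ξ j c n‖ * ‖P j‖ :=
    summable_sum fun j _ => ((hc.D hξ j).summable_norm).mul_right _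
  have key := hasFDerivAt_tsum (𝕜 := ℝ) (f := fun n x => c n * cgoChr (ξ n) x)
    (f' := fun n x => ∑ j, (cgoD ξ j c n * cgoChr (ξ n) x) • P j) (u := fun n => ∑ j, ‖cgoD ξ j c n‖ * ‖P j‖)
    hu ?_ ?_ (x₀ := 0) (cgoS_summable hc.summable_norm 0) x
  · refine key.congr_fderiv ?_
    rw [Summable.tsum_finsetSum]
    · refine Finset.sum_congr rfl fun j _ => ?_
      unfold cgoS
      rw [(cgoS_summable (hc.D hξ j).summable_norm x).tsum_smul_const]
    · intro j _
      exact (cgoS_summable (hc.D hξ j).summable_norm x).smul_const _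
  · intro n x
    have := (cgoChr_hasFDerivAt (ξ n) x).const_mul (c n)
    refine this.congr_fderiv ?_
    rw [Finset.smul_sum]
    refine Finset.sum_congr rfl fun j _ => ?_
    rw [smul_smul]
    congr 1
    unfold cgoD
    ring
  · intro n x
    refine (norm_sum_le _ _).trans (Finset.sum_le_sum fun j _ => ?_)
    rw [norm_smul, norm_mul, cgoChr_norm, mul_one]

theorem cgoS_contDiff_nat {ξ : (Fin 3 → ℤ) → Fin 3 → ℝ} (hξ : cgoPB ξ) (N : ℕ) :
    ∀ {c : (Fin 3 → ℤ) → ℂ}, cgoRD c → ContDiff ℝ N (cgoS ξ c) := by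
  induction N with
  | zero =>
    intro c hc
    exact contDiff_zero.2 (continuous_iff_continuousAt.2 fun x => (cgoS_hasFDerivAt hξ hc x).continuousAt)
  | succ N ih =>
    intro c hc
    have := contDiff_succ_iff_hasFDerivAt (𝕜 := ℝ) (n := N) (f := cgoS ξ c)
    push_cast
    rw [this]
    refine ⟨_, ?_, fun x => cgoS_hasFDerivAt hξ hc x⟩
    refine ContDiff.sum fun j _ => ?_
    exact (ih (hc.D hξ j)).smul contDiff_const

theorem cgoS_contDiff {ξ : (Fin 3 → ℤ) → Fin 3 → ℝ} (hξ : cgoPB ξ)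
    {c : (Fin 3 → ℤ) → ℂ} (hc : cgoRD c) : ContDiff ℝ (⊤ : ℕ∞) (cgoS ξ c) :=
  contDiff_infty.2 fun N => cgoS_contDiff_nat hξ N hc

theorem cgoS_pdC {ξ : (Fin 3 → ℤ) → Fin 3 → ℝ} (hξ : cgoPB ξ)
    {c : (Fin 3 → ℤ) → ℂ} (hc : cgoRD c) (j : Fin 3) (x : Fin 3 → ℝ) :
    pdC (cgoS ξ c) j x = cgoS ξ (cgoD ξ j c) x := by
  unfold pdC
  rw [(cgoS_hasFDerivAt hξ hc x).fderiv]
  simp [Pi.single_apply, apply_ite]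

theorem cgo_kernel_summable {J : Type*} {K : J → J → ℂ} {B : ℝ} (hK : ∀ j', Summable fun j => ‖K j j'‖)
    (hB : ∀ j', ∑' j, ‖K j j'‖ ≤ B) {c : J → ℂ} (hc : Summable fun j => ‖c j‖) :
    Summable (fun q : J × J => ‖K q.2 q.1 * c q.1‖) ∧
    ∑' q : J × J, ‖K q.2 q.1 * c q.1‖ ≤ B * ∑' j, ‖c j‖ := by
  have h1 : ∀ j', ∑' j, ‖K j j' * c j'‖ ≤ B * ‖c j'‖ := fun j' => by
    simp only [norm_mul]
    rw [tsum_mul_right]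
    gcongr
    exact hB j'
  have h0 : ∀ j', Summable fun j => ‖K j j' * c j'‖ := fun j' => by
    simp only [norm_mul]
    exact (hK j').mul_right _
  have h2 : Summable fun j' => ∑' j, ‖K j j' * c j'‖ :=
    Summable.of_nonneg_of_le (fun j' => tsum_nonneg fun j => norm_nonneg _) h1 (hc.mul_left B)
  have h3 : Summable (fun q : J × J => ‖K q.2 q.1 * c q.1‖) :=
    (summable_prod_of_nonneg fun q => norm_nonneg _).2 ⟨h0, h2⟩
  refine ⟨h3, ?_⟩
  rw [h3.tsum_prod, ← tsum_mul_left]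
  exact h2.tsum_le_tsum h1 (hc.mul_left B)

theorem cgo_kernel_apply {J : Type*} {K : J → J → ℂ} {B : ℝ} (hK : ∀ j', Summable fun j => ‖K j j'‖)
    (hB : ∀ j', ∑' j, ‖K j j'‖ ≤ B) {c : J → ℂ} (hc : Summable fun j => ‖c j‖) :
    (∀ j, Summable fun j' => K j j' * c j') ∧
    Summable (fun j => ‖∑' j', K j j' * c j'‖) ∧
    ∑' j, ‖∑' j', K j j' * c j'‖ ≤ B * ∑' j, ‖c j‖ := by
  obtain ⟨h1, h2⟩ := cgo_kernel_summable hK hB hc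
  have h3 : Summable (fun q : J × J => ‖K q.1 q.2 * c q.2‖) := h1.prod_symm
  have h4 : ∀ j, Summable fun j' => ‖K j j' * c j'‖ := fun j => h3.prod_factor j
  have h5 : Summable fun j => ∑' j', ‖K j j' * c j'‖ := h3.prod
  have h6 : ∀ j, ‖∑' j', K j j' * c j'‖ ≤ ∑' j', ‖K j j' * c j'‖ := fun j => norm_tsum_le_tsum_norm (h4 j)
  have h7 : Summable (fun j => ‖∑' j', K j j' * c j'‖) :=
    Summable.of_nonneg_of_le (fun j => norm_nonneg _) h6 h5
  refine ⟨fun j => (h4 j).of_norm, h7, ?_⟩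
  refine le_trans (h7.tsum_le_tsum h6 h5) (le_trans (le_of_eq ?_) h2)
  rw [← h3.tsum_prod]
  exact (Equiv.prodComm J J).tsum_eq (fun q : J × J => ‖K q.2 q.1 * c q.1‖)

theorem cgo_l1_unique {J : Type*} {K : J → J → ℂ} (hK : ∀ j', Summable fun j => ‖K j j'‖)
    (hB : ∀ j', ∑' j, ‖K j j'‖ ≤ 1 / 2) {c : J → ℂ} (hc : Summable fun j => ‖c j‖)
    (h : ∀ j, c j = ∑' j', K j j' * c j') : ∀ j, c j = 0 := by
  have h1 := (cgo_kernel_apply hK hB hc).2.2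
  simp only [← h] at h1
  have h2 : ∑' j, ‖c j‖ ≤ 0 := by linarith
  intro j
  have := hc.le_tsum j (fun i _ => norm_nonneg _)
  exact norm_le_zero_iff.1 (this.trans h2)

theorem cgo_l1_fix {J : Type*} {K : J → J → ℂ} (hK : ∀ j', Summable fun j => ‖K j j'‖)
    (hB : ∀ j', ∑' j, ‖K j j'‖ ≤ 1 / 2) {r : J → ℂ} (hr : Summable fun j => ‖r j‖) :
    ∃ c : J → ℂ, (Summable fun j => ‖c j‖) ∧ (∀ j, c j = ∑' j', K j j' * c j' + r j) ∧
      ∑' j, ‖c j‖ ≤ 2 * ∑' j, ‖r j‖ := by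
  have hmem : ∀ f : J → ℂ, Memℓp f 1 ↔ Summable fun j => ‖f j‖ := fun f => by
    rw [memℓp_gen_iff (by norm_num)]; simp
  have hnorm : ∀ f : lp (fun _ : J => ℂ) 1, ‖f‖ = ∑' j, ‖f j‖ := fun f => by
    rw [lp.norm_eq_tsum_rpow (by norm_num)]; simp
  have hs : ∀ f : lp (fun _ : J => ℂ) 1, Summable fun j => ‖f j‖ := fun f => (hmem f).1 f.2
  let T : lp (fun _ : J => ℂ) 1 → lp (fun _ : J => ℂ) 1 := fun f =>
    ⟨fun j => ∑' j', K j j' * f j' + r j, (hmem _).2 (Summable.of_nonneg_of_le (fun j => norm_nonneg _)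
      (fun j => norm_add_le _ _) (((cgo_kernel_apply hK hB (hs f)).2.1).add hr))⟩
  have hT : ∀ f j, T f j = ∑' j', K j j' * f j' + r j := fun f j => rfl
  have hcon : ContractingWith (1 / 2) T := by
    refine ⟨by rw [← NNReal.coe_lt_coe]; norm_num, LipschitzWith.of_dist_le_mul fun f g => ?_⟩
    rw [dist_eq_norm, dist_eq_norm, hnorm, hnorm]
    have h1 := (cgo_kernel_apply hK hB (hs (f - g))).2.2
    refine le_trans (le_of_eq ?_) (le_trans h1 ?_)
    · congr 1
      ext j
      rw [lp.coeFn_sub, Pi.sub_apply, hT, hT, add_sub_add_right_eq_sub,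
        ← ((cgo_kernel_apply hK hB (hs f)).1 j).tsum_sub ((cgo_kernel_apply hK hB (hs g)).1 j)]
      simp [mul_sub]
    · simp
  have : Nonempty (lp (fun _ : J => ℂ) 1) := ⟨0⟩
  have hfix : T (ContractingWith.fixedPoint T hcon) = _ := hcon.fixedPoint_isFixedPt
  set c := ContractingWith.fixedPoint T hcon
  have he : ∀ j, c j = ∑' j', K j j' * c j' + r j := fun j => by
    rw [← hT, hfix]
  refine ⟨c, hs c, he, ?_⟩
  have h1 := (cgo_kernel_apply hK hB (hs c))
  have h2 : ∑' j, ‖c j‖ ≤ ∑' j, ‖∑' j', K j j' * c j'‖ + ∑' j, ‖r j‖ := by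
    rw [← h1.2.1.tsum_add hr]
    refine (hs c).tsum_le_tsum (fun j => ?_) (h1.2.1.add hr)
    conv_lhs => rw [he j]
    exact norm_add_le _ _
  linarith [h1.2.2]

/-- convolution -/
noncomputable def cgoConv (p c : (Fin 3 → ℤ) → ℂ) (n : Fin 3 → ℤ) : ℂ := ∑' m, p (n - m) * c m

theorem cgo_shift_summable {f : (Fin 3 → ℤ) → ℝ} (hf : Summable f) (m : Fin 3 → ℤ) :
    (Summable fun n => f (n - m)) ∧ ∑' n, f (n - m) = ∑' n, f n :=
  ⟨(Equiv.subRight m).summable_iff.2 hf, (Equiv.subRight m).tsum_eq f⟩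

theorem cgoConv_l1 {p c : (Fin 3 → ℤ) → ℂ} (hp : Summable fun n => ‖p n‖) (hc : Summable fun n => ‖c n‖) :
    (∀ n, Summable fun m => p (n - m) * c m) ∧ (Summable fun n => ‖cgoConv p c n‖) ∧
    ∑' n, ‖cgoConv p c n‖ ≤ (∑' n, ‖p n‖) * ∑' n, ‖c n‖ :=
  cgo_kernel_apply (K := fun n m => p (n - m)) (fun m => (cgo_shift_summable hp m).1)
    (fun m => (cgo_shift_summable hp m).2.le) hc

theorem cgoConv_moment {p c : (Fin 3 → ℤ) → ℂ} (N : ℕ) (hp : Summable fun n => cgoWt n ^ N * ‖p n‖)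
    (hc : Summable fun n => cgoWt n ^ N * ‖c n‖) :
    Summable fun n => cgoWt n ^ N * ‖cgoConv p c n‖ := by
  have hw := cgoWt_pos
  have hn : ∀ (d : (Fin 3 → ℤ) → ℂ) n, ‖(cgoWt n : ℂ) ^ N * d n‖ = cgoWt n ^ N * ‖d n‖ := fun d n => by
    rw [norm_mul, norm_pow, Complex.norm_real, Real.norm_eq_abs, abs_of_pos (hw n)]
  have hp' : Summable fun n => ‖(cgoWt n : ℂ) ^ N * p n‖ := by simpa only [hn] using hp
  have hc' : Summable fun n => ‖(cgoWt n : ℂ) ^ N * c n‖ := by simpa only [hn] using hc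
  have h1 := (cgo_kernel_summable (K := fun n m => (cgoWt (n - m) : ℂ) ^ N * p (n - m))
    (fun m => (cgo_shift_summable hp' m).1)
    (fun m => (cgo_shift_summable hp' m).2.le) hc').1.prod_symm
  refine Summable.of_nonneg_of_le (fun n => by have := hw n; positivity) (fun n => ?_) h1.prod
  have h2 := h1.prod_factor n
  have h3 : ∀ m, cgoWt n ^ N * ‖p (n - m) * c m‖ ≤
      ‖(cgoWt (n - m) : ℂ) ^ N * p (n - m) * ((cgoWt m : ℂ) ^ N * c m)‖ := fun m => by
    rw [norm_mul (_ * _), hn c, norm_mul (_ ^ _), norm_pow, Complex.norm_real, Real.norm_eq_abs,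
      abs_of_pos (hw _), norm_mul]
    have h4 := cgoWt_add (n - m) m
    rw [sub_add_cancel] at h4
    have h5 : cgoWt n ^ N ≤ cgoWt (n - m) ^ N * cgoWt m ^ N := by
      rw [← mul_pow]
      exact pow_le_pow_left₀ (hw n).le h4 N
    calc _ ≤ (cgoWt (n - m) ^ N * cgoWt m ^ N) * (‖p (n - m)‖ * ‖c m‖) := by gcongr
      _ = _ := by ring
  have h4 : Summable fun m => cgoWt n ^ N * ‖p (n - m) * c m‖ :=
    Summable.of_nonneg_of_le (fun m => by have := hw n; positivity) h3 h2
  have h5 : Summable fun m => ‖p (n - m) * c m‖ := by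
    have := h4.mul_left ((cgoWt n ^ N)⁻¹)
    have h6 := (pow_pos (hw n) N).ne'
    simpa [← mul_assoc, inv_mul_cancel₀ h6] using this
  calc cgoWt n ^ N * ‖cgoConv p c n‖ ≤ cgoWt n ^ N * ∑' m, ‖p (n - m) * c m‖ := by
        have := hw n
        gcongr
        exact norm_tsum_le_tsum_norm h5
    _ = ∑' m, cgoWt n ^ N * ‖p (n - m) * c m‖ := tsum_mul_left.symm
    _ ≤ _ := h4.tsum_le_tsum h3 h2

theorem cgoRD.conv {p c : (Fin 3 → ℤ) → ℂ} (hp : cgoRD p) (hc : cgoRD c) : cgoRD (cgoConv p c) :=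
  fun N => cgoConv_moment N (hp N) (hc N)

theorem cgoS_conv {ξ₀ ξ : (Fin 3 → ℤ) → Fin 3 → ℝ} (hξ : ∀ n m, ξ n = fun j => ξ₀ (n - m) j + ξ m j)
    {p c : (Fin 3 → ℤ) → ℂ} (hp : cgoRD p) (hc : cgoRD c) (x : Fin 3 → ℝ) :
    cgoS ξ (cgoConv p c) x = cgoS ξ₀ p x * cgoS ξ c x := by
  have h1 := (cgo_kernel_summable (K := fun n m => p (n - m))
    (fun m => (cgo_shift_summable hp.summable_norm m).1)
    (fun m => (cgo_shift_summable hp.summable_norm m).2.le) hc.summable_norm).1.prod_symm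
  have h2 : Summable (Function.uncurry fun n m => p (n - m) * c m * cgoChr (ξ n) x) := by
    refine Summable.of_norm ?_
    refine h1.congr fun q => ?_
    simp [Function.uncurry, cgoChr_norm]
  calc cgoS ξ (cgoConv p c) x = ∑' n, ∑' m, p (n - m) * c m * cgoChr (ξ n) x := by
        unfold cgoS cgoConv
        simp only [tsum_mul_right]
    _ = ∑' m, ∑' n, p (n - m) * c m * cgoChr (ξ n) x := h2.tsum_comm.symm
    _ = ∑' m, cgoS ξ₀ p x * (c m * cgoChr (ξ m) x) := by
        congr 1
        ext m
        unfold cgoS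
        rw [← tsum_mul_right, ← (Equiv.subRight m).tsum_eq (fun n => p n * cgoChr (ξ₀ n) x * _)]
        congr 1
        ext n
        rw [hξ n m, cgoChr_add]
        simp only [Equiv.subRight_apply]
        ring
    _ = _ := by rw [tsum_mul_left]; rfl

theorem cgo_solve {ι : Type} [Fintype ι] {p : ι → ι → (Fin 3 → ℤ) → ℂ} (hp : ∀ a b, cgoRD (p a b))
    {B : ℝ} (hB : ∀ b, ∑ a, ∑' n, ‖p a b n‖ ≤ B) {r : ι → (Fin 3 → ℤ) → ℂ} (hr : ∀ a, cgoRD (r a))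
    {μ : (Fin 3 → ℤ) → ℂ} {δ K : ℝ} (hμ : ∀ n, ‖μ n‖ ≤ δ) (hδ : δ * B ≤ 1 / 2)
    (hμ' : ∀ n, cgoWt n * ‖μ n‖ ≤ K) :
    ∃ c : ι → (Fin 3 → ℤ) → ℂ, (∀ a, cgoRD (c a)) ∧
      (∀ a n, c a n = μ n * (∑ b, cgoConv (p a b) (c b) n + r a n)) ∧
      (∀ a, ∑' n, ‖c a n‖ ≤ 2 * δ * ∑ a, ∑' n, ‖r a n‖) ∧
      (∀ a, ∑' n, cgoWt n * ‖c a n‖ ≤ 2 * K * ∑ a, ∑' n, ‖r a n‖) := by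
  have hδ0 : 0 ≤ δ := (norm_nonneg _).trans (hμ 0)
  have hK0 : 0 ≤ K := le_trans (mul_nonneg (cgoWt_pos 0).le (norm_nonneg _)) (hμ' 0)
  have hprod : ∀ f : (Fin 3 → ℤ) × ι → ℝ, (∀ q, 0 ≤ f q) → (∀ a, Summable fun n => f (n, a)) →
      Summable f ∧ ∑' q, f q = ∑ a, ∑' n, f (n, a) := fun f hf h => by
    have h1 : Summable f := (summable_prod_of_nonneg hf).2
      ⟨fun n => Summable.of_finite, by simpa [tsum_fintype] using summable_sum fun a _ => h a⟩
    refine ⟨h1, ?_⟩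
    rw [h1.tsum_prod, ← Summable.tsum_finsetSum fun a _ => h a]
    simp [tsum_fintype]
  let Kr : (Fin 3 → ℤ) × ι → (Fin 3 → ℤ) × ι → ℂ := fun q q' => μ q.1 * p q.2 q'.2 (q.1 - q'.1)
  have hle : ∀ q' a n, ‖Kr (n, a) q'‖ ≤ δ * ‖p a q'.2 (n - q'.1)‖ := fun q' a n => by
    simp only [Kr, norm_mul]
    gcongr
    exact hμ n
  have hsh : ∀ (q' : (Fin 3 → ℤ) × ι) a, Summable fun n => δ * ‖p a q'.2 (n - q'.1)‖ := fun q' a =>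
    ((cgo_shift_summable (hp a q'.2).summable_norm q'.1).1).mul_left δ
  have hs1 : ∀ q' a, Summable fun n => ‖Kr (n, a) q'‖ := fun q' a =>
    Summable.of_nonneg_of_le (fun n => norm_nonneg _) (hle q' a) (hsh q' a)
  have hs2 : ∀ q', Summable fun q => ‖Kr q q'‖ := fun q' =>
    (hprod (fun q => ‖Kr q q'‖) (fun _ => norm_nonneg _) (hs1 q')).1
  have hs3 : ∀ q', ∑' q, ‖Kr q q'‖ ≤ 1 / 2 := fun q' => by
    rw [(hprod (fun q => ‖Kr q q'‖) (fun _ => norm_nonneg _) (hs1 q')).2]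
    refine le_trans ?_ (le_trans (mul_le_mul_of_nonneg_left (hB q'.2) hδ0) hδ)
    rw [Finset.mul_sum]
    refine Finset.sum_le_sum fun a _ => ?_
    refine ((hs1 q' a).tsum_le_tsum (hle q' a) (hsh q' a)).trans_eq ?_
    rw [tsum_mul_left, (cgo_shift_summable (hp a q'.2).summable_norm q'.1).2]
  have hr1 : ∀ a, Summable fun n => ‖μ n * r a n‖ := fun a =>
    Summable.of_nonneg_of_le (fun n => norm_nonneg _) (fun n => by
      rw [norm_mul]; exact mul_le_mul_of_nonneg_right (hμ n) (norm_nonneg _))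
      ((hr a).summable_norm.mul_left δ)
  have hr2 := hprod (fun q => ‖μ q.1 * r q.2 q.1‖) (fun _ => norm_nonneg _) hr1
  have hr3 : ∑' q : (Fin 3 → ℤ) × ι, ‖μ q.1 * r q.2 q.1‖ ≤ δ * ∑ a, ∑' n, ‖r a n‖ := by
    rw [hr2.2, Finset.mul_sum]
    refine Finset.sum_le_sum fun a _ => ?_
    rw [← tsum_mul_left]
    refine (hr1 a).tsum_le_tsum (fun n => ?_) ((hr a).summable_norm.mul_left δ)
    rw [norm_mul]; exact mul_le_mul_of_nonneg_right (hμ n) (norm_nonneg _)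
  obtain ⟨c, hc1, hc2, hc3⟩ := cgo_l1_fix hs2 hs3 hr2.1
  have hcs : ∀ a, Summable fun n => ‖c (n, a)‖ := fun a =>
    hc1.comp_injective (i := fun n => (n, a)) fun x y h => by simpa using h
  have hctot : ∑ a, ∑' n, ‖c (n, a)‖ ≤ 2 * δ * ∑ a, ∑' n, ‖r a n‖ := by
    rw [← (hprod (fun q => ‖c q‖) (fun _ => norm_nonneg _) hcs).2]
    linarith
  have hceq : ∀ a n, c (n, a) = μ n * (∑ b, cgoConv (p a b) (fun m => c (m, b)) n + r a n) := fun a n => by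
    conv_lhs => rw [hc2]
    rw [((cgo_kernel_apply hs2 hs3 hc1).1 (n, a)).tsum_prod, mul_add, Finset.mul_sum]
    congr 1
    simp only [tsum_fintype, Kr]
    rw [Summable.tsum_finsetSum]
    · refine Finset.sum_congr rfl fun b _ => ?_
      unfold cgoConv
      rw [← tsum_mul_left]
      simp only [mul_assoc]
    · intro b _
      simp only [mul_assoc]
      exact ((cgoConv_l1 (hp a b).summable_norm (hcs b)).1 n).mul_left _
  have hRHS : ∀ N, (∀ a, Summable fun n => cgoWt n ^ N * ‖c (n, a)‖) → ∀ a,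
      Summable fun n => cgoWt n ^ N * ‖∑ b, cgoConv (p a b) (fun m => c (m, b)) n + r a n‖ := fun N h a => by
    refine Summable.of_nonneg_of_le (fun n => by have := cgoWt_pos n; positivity) (fun n => ?_)
      ((summable_sum (s := Finset.univ) fun b _ => cgoConv_moment N (hp a b N) (h b)).add (hr a N))
    have := cgoWt_pos n
    rw [← Finset.mul_sum, ← mul_add]
    gcongr
    exact (norm_add_le _ _).trans (by gcongr; exact norm_sum_le _ _)
  have hptw : ∀ N a n, cgoWt n ^ (N + 1) * ‖c (n, a)‖ ≤
      K * (cgoWt n ^ N * ‖∑ b, cgoConv (p a b) (fun m => c (m, b)) n + r a n‖) := fun N a n => by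
    have := cgoWt_pos n
    conv_lhs => rw [hceq, norm_mul]
    calc _ = (cgoWt n * ‖μ n‖) * (cgoWt n ^ N * ‖∑ b, cgoConv (p a b) (fun m => c (m, b)) n + r a n‖) := by
          ring
      _ ≤ _ := by gcongr; exact hμ' n
  have hRD : ∀ N a, Summable fun n => cgoWt n ^ N * ‖c (n, a)‖ := by
    intro N
    induction N with
    | zero => simpa using hcs
    | succ N ih =>
      intro a
      exact Summable.of_nonneg_of_le (fun n => by have := cgoWt_pos n; positivity) (hptw N a)
        ((hRHS N ih a).mul_left K)
  refine ⟨fun a n => c (n, a), fun a N => hRD N a, hceq, fun a => ?_, fun a => ?_⟩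
  · refine le_trans ?_ hctot
    exact Finset.single_le_sum (f := fun a => ∑' n, ‖c (n, a)‖) (fun a _ => tsum_nonneg fun n => norm_nonneg _)
      (Finset.mem_univ a)
  · have h1 : ∀ b, Summable fun n => ‖cgoConv (p a b) (fun m => c (m, b)) n‖ := fun b =>
      (cgoConv_l1 (hp a b).summable_norm (hcs b)).2.1
    have h2 : ∑' n, cgoWt n * ‖c (n, a)‖ ≤ ∑' n, K * (∑ b, ‖cgoConv (p a b) (fun m => c (m, b)) n‖ + ‖r a n‖) := by
      refine Summable.tsum_le_tsum (fun n => ?_) (by simpa using hRD 1 a)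
        (((summable_sum (s := Finset.univ) fun b _ => h1 b).add (hr a).summable_norm).mul_left K)
      have := hptw 0 a n
      simp only [zero_add, pow_one, pow_zero, one_mul] at this
      refine this.trans ?_
      gcongr
      exact (norm_add_le _ _).trans (by gcongr; exact norm_sum_le _ _)
    refine h2.trans ?_
    rw [tsum_mul_left, (summable_sum (s := Finset.univ) fun b _ => h1 b).tsum_add (hr a).summable_norm,
      Summable.tsum_finsetSum (s := Finset.univ) fun b _ => h1 b]
    have hB0 : ∀ b, ∑' n, ‖p a b n‖ ≤ B := fun b => le_trans
      (Finset.single_le_sum (f := fun a => ∑' n, ‖p a b n‖) (fun a _ => tsum_nonneg fun n => norm_nonneg _)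
      (Finset.mem_univ a)) (hB b)
    have hBn : 0 ≤ B := (tsum_nonneg fun n => norm_nonneg _).trans (hB0 a)
    have h3 : ∑ b, ∑' n, ‖cgoConv (p a b) (fun m => c (m, b)) n‖ ≤ B * ∑ b, ∑' n, ‖c (n, b)‖ := by
      rw [Finset.mul_sum]
      refine Finset.sum_le_sum fun b _ => ((cgoConv_l1 (hp a b).summable_norm (hcs b)).2.2).trans ?_
      have : 0 ≤ ∑' n, ‖c (n, b)‖ := tsum_nonneg fun n => norm_nonneg _
      gcongr
      exact hB0 b
    have h4 : ∑' n, ‖r a n‖ ≤ ∑ a, ∑' n, ‖r a n‖ :=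
      Finset.single_le_sum (f := fun a => ∑' n, ‖r a n‖) (fun a _ => tsum_nonneg fun n => norm_nonneg _)
      (Finset.mem_univ a)
    have h5 : 0 ≤ ∑ a, ∑' n, ‖r a n‖ := (tsum_nonneg fun n => norm_nonneg _).trans h4
    have h6 : B * ∑ b, ∑' n, ‖c (n, b)‖ ≤ ∑ a, ∑' n, ‖r a n‖ := by
      calc _ ≤ B * (2 * δ * ∑ a, ∑' n, ‖r a n‖) := by gcongr
        _ = 2 * (δ * B) * ∑ a, ∑' n, ‖r a n‖ := by ring
        _ ≤ 2 * (1 / 2) * ∑ a, ∑' n, ‖r a n‖ := by gcongr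
        _ = _ := by ring
    calc _ ≤ K * (∑ a, ∑' n, ‖r a n‖ + ∑ a, ∑' n, ‖r a n‖) := 
          mul_le_mul_of_nonneg_left (add_le_add (h3.trans h6) h4) hK0
      _ = _ := by ring

theorem cgo_unique {p c : (Fin 3 → ℤ) → ℂ} (hp : cgoRD p) (hc : cgoRD c) {μ : (Fin 3 → ℤ) → ℂ} {δ : ℝ}
    (hμ : ∀ n, ‖μ n‖ ≤ δ) (hδ : δ * ∑' n, ‖p n‖ ≤ 1 / 2) (h : ∀ n, c n = μ n * cgoConv p c n) :
    ∀ n, c n = 0 := by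
  have hδ0 : 0 ≤ δ := (norm_nonneg _).trans (hμ 0)
  have hle : ∀ m n, ‖μ n * p (n - m)‖ ≤ δ * ‖p (n - m)‖ := fun m n => by
    rw [norm_mul]
    gcongr
    exact hμ n
  have hs := fun m => ((cgo_shift_summable hp.summable_norm m).1).mul_left δ
  have hs1 : ∀ m, Summable fun n => ‖μ n * p (n - m)‖ := fun m =>
    Summable.of_nonneg_of_le (fun n => norm_nonneg _) (hle m) (hs m)
  refine cgo_l1_unique (K := fun n m => μ n * p (n - m)) hs1 (fun m => ?_) hc.summable_norm fun n => ?_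
  · refine ((hs1 m).tsum_le_tsum (hle m) (hs m)).trans ?_
    rw [tsum_mul_left, (cgo_shift_summable hp.summable_norm m).2]
    exact hδ
  · conv_lhs => rw [h n]
    unfold cgoConv
    rw [← tsum_mul_left]
    simp only [mul_assoc]

open scoped FourierTransform

@[reducible]
noncomputable def cgoMS : MeasureTheory.MeasureSpace UnitAddCircle := ⟨AddCircle.haarAddCircle⟩

attribute [local instance] cgoMS

theorem cgoMS_prob : MeasureTheory.IsProbabilityMeasure (MeasureTheory.volume : MeasureTheory.Measure UnitAddCircle) :=
  inferInstanceAs (MeasureTheory.IsProbabilityMeasure AddCircle.haarAddCircle)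

attribute [local instance] cgoMS_prob

theorem cgoWt_summable : Summable fun n : Fin 3 → ℤ => (cgoWt n ^ 6)⁻¹ := by
  have h1 : Summable fun m : ℤ => ((1 + |(m : ℝ)|) ^ 2)⁻¹ := by
    refine Summable.of_nonneg_of_le (fun m => by positivity) (fun m => ?_)
      (f := fun m : ℤ => 1 / (m : ℝ) ^ 2 + if m = 0 then 1 else 0)
      ((Real.summable_one_div_int_pow.2 (by norm_num)).add (summable_of_hasFiniteSupport ?_))
    · by_cases hm : m = 0
      · simp [hm]
      · simp only [hm, if_false, add_zero, one_div]
        have : 0 < |(m : ℝ)| := by positivity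
        rw [← sq_abs (m : ℝ)]
        gcongr
        linarith
    · refine (Set.finite_singleton (0 : ℤ)).subset fun m hm => ?_
      by_contra h
      simp at h
      simp [h] at hm
  refine summable_of_sum_le (c := (∑' m : ℤ, ((1 + |(m : ℝ)|) ^ 2)⁻¹) ^ 3)
    (fun n => by have := cgoWt_pos n; positivity) fun u => ?_
  have hsub : u ⊆ Fintype.piFinset (fun i => u.image fun n => n i) := fun n hn => by
    simp only [Fintype.mem_piFinset, Finset.mem_image]
    exact fun i => ⟨n, hn, rfl⟩
  calc ∑ n ∈ u, (cgoWt n ^ 6)⁻¹ ≤ ∑ n ∈ u, ∏ i, ((1 + |(n i : ℝ)|) ^ 2)⁻¹ := by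
        refine Finset.sum_le_sum fun n _ => ?_
        have h : ∀ i, 1 + |(n i : ℝ)| ≤ cgoWt n := fun i => by
          unfold cgoWt
          have := norm_le_pi_norm n i
          rw [Int.norm_eq_abs] at this
          linarith
        have h0 := cgoWt_pos n
        calc (cgoWt n ^ 6)⁻¹ = ∏ i : Fin 3, (cgoWt n ^ 2)⁻¹ := by
              simp [← pow_mul]
          _ ≤ _ := by
              refine Finset.prod_le_prod (fun i _ => by positivity) fun i _ => ?_
              gcongr
              exact h i
    _ ≤ ∑ n ∈ Fintype.piFinset (fun i => u.image fun n : Fin 3 → ℤ => n i), ∏ i, ((1 + |((n i : ℤ) : ℝ)|) ^ 2)⁻¹ :=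
        Finset.sum_le_sum_of_subset_of_nonneg hsub fun n _ _ => Finset.prod_nonneg fun i _ => by positivity
    _ = ∏ i, ∑ m ∈ u.image (fun n : Fin 3 → ℤ => n i), ((1 + |((m : ℤ) : ℝ)|) ^ 2)⁻¹ :=
        (Finset.prod_univ_sum _ fun _ (m : ℤ) => ((1 + |(m : ℝ)|) ^ 2)⁻¹).symm
    _ ≤ ∏ i : Fin 3, ∑' m : ℤ, ((1 + |(m : ℝ)|) ^ 2)⁻¹ := by
        refine Finset.prod_le_prod (fun i _ => Finset.sum_nonneg fun m _ => by positivity) fun i _ => ?_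
        exact h1.sum_le_tsum _ fun m _ => by positivity
    _ = _ := by simp

theorem cgoRD_of_decay {c : (Fin 3 → ℤ) → ℂ} (h : ∀ N : ℕ, ∃ C, ∀ n, cgoWt n ^ N * ‖c n‖ ≤ C) : cgoRD c := by
  intro N
  obtain ⟨C, hC⟩ := h (N + 6)
  refine Summable.of_nonneg_of_le (fun n => by have := cgoWt_pos n; positivity) (fun n => ?_)
    (cgoWt_summable.mul_left C)
  have := cgoWt_pos n
  rw [← div_eq_mul_inv, le_div_iff₀ (by positivity)]
  refine le_trans (le_of_eq ?_) (hC n)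
  ring

theorem cgo_mFourier_apply (n : Fin 3 → ℤ) (y : Fin 3 → ℝ) :
    UnitAddTorus.mFourier n (fun i => (y i : UnitAddCircle)) =
      Complex.exp (2 * Real.pi * Complex.I * ((∑ i, (n i : ℝ) * y i : ℝ) : ℂ)) := by
  simp only [UnitAddTorus.mFourier, ContinuousMap.coe_mk, fourier_coe_apply, ← Complex.exp_sum]
  congr 1
  push_cast
  rw [Finset.mul_sum]
  refine Finset.sum_congr rfl fun i _ => ?_
  simp only [div_one]
  ring

theorem cgo_fourier (H : (Fin 3 → ℝ) → ℂ) (hH : ContDiff ℝ (⊤ : ℕ∞) H)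
    (hs : tsupport H ⊆ Metric.ball 0 (1 / 2)) :
    ∃ p, cgoRD p ∧ ∀ y ∈ Metric.ball (0 : Fin 3 → ℝ) (1 / 2),
      HasSum (fun n => p n * Complex.exp (2 * Real.pi * Complex.I * ((∑ i, (n i : ℝ) * y i : ℝ) : ℂ))) (H y) := by
  obtain ⟨r, hr, hsr⟩ := exists_lt_subset_ball (isClosed_tsupport H) hs
  have hzero : ∀ y, r ≤ ‖y‖ → H y = 0 := fun y hy => by
    by_contra h
    have := hsr (subset_tsupport H h)
    simp at this
    linarith
  have hcs : HasCompactSupport H :=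
    HasCompactSupport.of_support_subset_isCompact (isCompact_closedBall 0 r)
      ((subset_tsupport H).trans (hsr.trans Metric.ball_subset_closedBall))
  let rep : UnitAddTorus (Fin 3) → Fin 3 → ℝ := fun t i => (AddCircle.equivIoc (1 : ℝ) (-(1 / 2)) (t i) : ℝ)
  have hrep : ∀ t i, ‖t i‖ ≤ |rep t i| := fun t i => by
    have h1 : ((rep t i : ℝ) : AddCircle (1 : ℝ)) = t i := AddCircle.coe_equivIoc
    rw [← h1]
    exact QuotientAddGroup.norm_mk_le_norm
  have hrep2 : ∀ y : Fin 3 → ℝ, (∀ i, y i ∈ Set.Ioc (-(1 / 2) : ℝ) (-(1 / 2) + 1)) →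
      rep (fun i => (y i : UnitAddCircle)) = y := fun y hy => by
    funext i
    exact AddCircle.equivIoc_coe_of_mem (hy i)
  have hcont : Continuous fun t => H (rep t) := by
    refine continuous_iff_continuousAt.2 fun t => ?_
    by_cases ht : ∃ i, r < ‖t i‖
    · obtain ⟨i, hi⟩ := ht
      have hev : ∀ᶠ t' : UnitAddTorus (Fin 3) in nhds t, r < ‖t' i‖ :=
        (isOpen_lt continuous_const ((continuous_apply i).norm)).mem_nhds hi
      refine (continuousAt_const (y := (0 : ℂ))).congr ?_
      filter_upwards [hev] with t' ht'
      exact (hzero _ (ht'.le.trans ((hrep t' i).trans (norm_le_pi_norm (rep t') i)))).symm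
    · push Not at ht
      have : ContinuousAt rep t := by
        refine continuousAt_pi.2 fun i => ?_
        refine continuous_subtype_val.continuousAt.comp ?_
        refine ContinuousAt.comp (f := fun t : UnitAddTorus (Fin 3) => t i)
          (AddCircle.continuousAt_equivIoc (1 : ℝ) _ ?_) (continuous_apply i).continuousAt
        intro h
        have h2 := AddCircle.norm_half_period_eq 1
        have h3 := ht i
        rw [h, AddCircle.coe_neg, norm_neg, h2] at h3
        norm_num at h3
        linarith
      exact hH.continuous.continuousAt.comp this
  let F : C(UnitAddTorus (Fin 3), ℂ) := ⟨fun t => H (rep t), hcont⟩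
  have hEu : ContDiff ℝ (⊤ : ℕ∞) fun z : EuclideanSpace ℝ (Fin 3) => H z.ofLp :=
    hH.comp (PiLp.continuousLinearEquiv 2 ℝ fun _ : Fin 3 => ℝ).contDiff
  have hEc : HasCompactSupport fun z : EuclideanSpace ℝ (Fin 3) => H z.ofLp :=
    hcs.comp_homeomorph (PiLp.continuousLinearEquiv 2 ℝ fun _ : Fin 3 => ℝ).toHomeomorph
  let S := hEc.toSchwartzMap hEu
  let Sh := 𝓕 S
  have hcoef : ∀ n, UnitAddTorus.mFourierCoeff F n = Sh (WithLp.toLp 2 fun i => (n i : ℝ)) := fun n => by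
    rw [UnitAddTorus.mFourierCoeff_eq_integral F n (fun _ => -(1 / 2))]
    simp only [Sh, SchwartzMap.fourier_coe, Real.fourier_eq']
    rw [← (PiLp.volume_preserving_toLp (Fin 3)).integral_comp
      (MeasurableEquiv.toLp 2 (Fin 3 → ℝ)).measurableEmbedding]
    refine Eq.trans ?_ (MeasureTheory.setIntegral_eq_integral_of_forall_compl_eq_zero
      (s := {x : Fin 3 → ℝ | ∀ i, x i ∈ Set.Ioc (-(1 / 2) : ℝ) (-(1 / 2) + 1)}) ?_)
    · refine MeasureTheory.setIntegral_congr_fun ?_ fun y hy => ?_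
      · exact MeasurableSet.univ_pi' (fun i => measurableSet_Ioc)
      · rw [cgo_mFourier_apply]
        have : F (fun i => (y i : UnitAddCircle)) = H y := congrArg H (hrep2 y hy)
        rw [this]
        congr 1
        congr 1
        simp [PiLp.inner_apply]
        ring
    · intro y hy
      have : H y = 0 := by
        refine hzero y ?_
        by_contra h
        push Not at h
        refine hy fun i => ?_
        have h2 := (norm_le_pi_norm y i).trans_lt (h.trans hr)
        rw [Real.norm_eq_abs, abs_lt] at h2
        constructor <;> linarith
      simp [S, this]
  have hRD : cgoRD (UnitAddTorus.mFourierCoeff F) := by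
    refine cgoRD_of_decay fun N => ?_
    refine ⟨2 ^ N * ((Finset.Iic ((N, 0) : ℕ × ℕ)).sup fun m => SchwartzMap.seminorm ℝ m.1 m.2) Sh, fun n => ?_⟩
    · have h := SchwartzMap.one_add_le_sup_seminorm_apply (𝕜 := ℝ) (m := (N, 0)) le_rfl le_rfl Sh
        (WithLp.toLp 2 fun i => (n i : ℝ))
      rw [norm_iteratedFDeriv_zero, ← hcoef] at h
      refine le_trans ?_ h
      gcongr
      · exact (cgoWt_pos n).le
      unfold cgoWt
      gcongr
      refine (pi_norm_le_iff_of_nonneg (norm_nonneg _)).2 fun i => ?_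
      have := PiLp.norm_apply_le (WithLp.toLp 2 fun i => (n i : ℝ) : EuclideanSpace ℝ (Fin 3)) i
      rw [Int.norm_eq_abs]
      simpa using this
  refine ⟨_, hRD, fun y hy => ?_⟩
  have h := UnitAddTorus.hasSum_mFourier_series_apply_of_summable (f := F) hRD.summable_norm.of_norm
    (fun i => (y i : UnitAddCircle))
  have hy' : ∀ i, y i ∈ Set.Ioc (-(1 / 2) : ℝ) (-(1 / 2) + 1) := fun i => by
    have h2 := (norm_le_pi_norm y i).trans_lt (mem_ball_zero_iff.1 hy)
    rw [Real.norm_eq_abs, abs_lt] at h2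
    constructor <;> linarith
  have : F (fun i => (y i : UnitAddCircle)) = H y := congrArg H (hrep2 y hy')
  rw [this] at h
  simpa only [cgo_mFourier_apply, smul_eq_mul] using h

theorem cgo_fourier_inj {c : (Fin 3 → ℤ) → ℂ} (hc : cgoRD c)
    (h : ∀ y ∈ Metric.ball (0 : Fin 3 → ℝ) (1 / 2),
      ∑' n, c n * Complex.exp (2 * Real.pi * Complex.I * ((∑ i, (n i : ℝ) * y i : ℝ) : ℂ)) = 0) :
    ∀ n, c n = 0 := by
  have hsum : Summable fun n => c n • UnitAddTorus.mFourier n := by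
    refine Summable.of_norm ?_
    simpa only [norm_smul, UnitAddTorus.mFourier_norm, mul_one] using hc.summable_norm
  obtain ⟨F, hF⟩ := hsum
  have hF0' : ∀ y : Fin 3 → ℝ, F (fun i => (y i : UnitAddCircle)) =
      ∑' n, c n * Complex.exp (2 * Real.pi * Complex.I * ((∑ i, (n i : ℝ) * y i : ℝ) : ℂ)) := fun y => by
    have h1 := (ContinuousMap.evalCLM ℂ (fun i => (y i : UnitAddCircle))).hasSum hF
    refine Eq.trans h1.tsum_eq.symm ?_
    refine tsum_congr fun n => ?_
    rw [← cgo_mFourier_apply]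
    rfl
  have hF0 : F = 0 := by
    ext t
    let G : (Fin 3 → ℝ) → ℂ := fun y => F (fun i => (y i : UnitAddCircle))
    have hG : Continuous G := by
      refine F.continuous.comp ?_
      exact continuous_pi fun i => (AddCircle.continuous_mk' 1).comp (continuous_apply i)
    have hG0 : Set.EqOn G 0 (closure (Metric.ball 0 (1 / 2))) := by
      refine Set.EqOn.closure (fun y hy => ?_) hG continuous_const
      exact (hF0' y).trans (h y hy)
    rw [closure_ball _ (by norm_num)] at hG0
    let y : Fin 3 → ℝ := fun i => (AddCircle.equivIoc (1 : ℝ) (-(1 / 2)) (t i) : ℝ)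
    have hy : y ∈ Metric.closedBall 0 (1 / 2) := by
      rw [mem_closedBall_zero_iff, pi_norm_le_iff_of_nonneg (by norm_num)]
      intro i
      have := (AddCircle.equivIoc (1 : ℝ) (-(1 / 2)) (t i)).2
      rw [Real.norm_eq_abs, abs_le]
      constructor
      · exact this.1.le
      · exact this.2.trans (by norm_num)
    have h1 := hG0 hy
    have h2 : (fun i => (y i : UnitAddCircle)) = t := funext fun i => AddCircle.coe_equivIoc
    simp only [G, h2] at h1
    simpa using h1
  subst hF0
  intro m
  have h2 := ((innerSL ℂ (UnitAddTorus.mFourierLp 2 m)).comp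
    (ContinuousMap.toLp 2 MeasureTheory.volume ℂ)).hasSum hF
  have h3 := orthonormal_iff_ite.1 (UnitAddTorus.orthonormal_mFourier (d := Fin 3)) m
  have h4 : ∀ n, ((innerSL ℂ (UnitAddTorus.mFourierLp 2 m)).comp
    (ContinuousMap.toLp 2 MeasureTheory.volume ℂ)) (c n • UnitAddTorus.mFourier n) = if n = m then c m else 0 := by
    intro n
    have := h3 n
    rw [map_smul]
    simp only [ContinuousLinearMap.comp_apply, innerSL_apply_apply]
    unfold UnitAddTorus.mFourierLp at this
    unfold UnitAddTorus.mFourierLp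
    refine (congrArg (c n • ·) this).trans ?_
    by_cases hnm : n = m
    · simp [hnm]
    · simp [hnm, Ne.symm hnm]
  have h5 := h2.unique ((hasSum_ite_eq m (c m)).congr_fun h4)
  simpa using h5.symm


def cgoON (e : Fin 3 → Fin 3 → ℝ) : Prop := ∀ i j, ∑ k, e i k * e j k = if i = j then 1 else 0

noncomputable def cgoT (e : Fin 3 → Fin 3 → ℝ) (ω : ℝ) (x : Fin 3 → ℝ) : Fin 3 → ℝ :=
  fun i => ω / (2 * Real.pi) * ∑ k, e i k * x k

noncomputable def cgoTi (e : Fin 3 → Fin 3 → ℝ) (ω : ℝ) (y : Fin 3 → ℝ) : Fin 3 → ℝ :=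
  fun k => 2 * Real.pi / ω * ∑ i, e i k * y i

def cgoU (e : Fin 3 → Fin 3 → ℝ) (ω : ℝ) : Set (Fin 3 → ℝ) := {x | cgoT e ω x ∈ Metric.ball 0 (1 / 2)}

theorem cgoON.cols {e : Fin 3 → Fin 3 → ℝ} (he : cgoON e) (k l : Fin 3) :
    ∑ i, e i k * e i l = if k = l then 1 else 0 := by
  have h : (Matrix.of e) * (Matrix.of e).transpose = 1 := by
    ext i j
    simp [Matrix.mul_apply, he i j, Matrix.one_apply]
  have h2 := mul_eq_one_comm.1 h
  have := congrFun (congrFun h2 k) l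
  simpa [Matrix.mul_apply, Matrix.one_apply] using this

theorem cgoT_Ti {e : Fin 3 → Fin 3 → ℝ} (he : cgoON e) {ω : ℝ} (hω : 0 < ω) (y : Fin 3 → ℝ) :
    cgoT e ω (cgoTi e ω y) = y := by
  funext i
  have hpi := Real.pi_pos
  have h1 : ∑ k, e i k * ∑ j, e j k * y j = y i := by
    calc _ = ∑ j, (∑ k, e i k * e j k) * y j := by
          simp only [Finset.mul_sum, Finset.sum_mul]
          rw [Finset.sum_comm]
          simp only [mul_assoc]
      _ = _ := by simp [he i]
  unfold cgoT cgoTi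
  conv_rhs => rw [← h1]
  rw [Finset.mul_sum, ]
  refine Finset.sum_congr rfl fun k _ => ?_
  field_simp

theorem cgoTi_T {e : Fin 3 → Fin 3 → ℝ} (he : cgoON e) {ω : ℝ} (hω : 0 < ω) (x : Fin 3 → ℝ) :
    cgoTi e ω (cgoT e ω x) = x := by
  funext k
  have hpi := Real.pi_pos
  have h1 : ∑ i, e i k * ∑ l, e i l * x l = x k := by
    calc _ = ∑ l, (∑ i, e i k * e i l) * x l := by
          simp only [Finset.mul_sum, Finset.sum_mul]
          rw [Finset.sum_comm]
          simp only [mul_assoc]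
      _ = _ := by simp [he.cols k]
  unfold cgoT cgoTi
  conv_rhs => rw [← h1]
  rw [Finset.mul_sum, ]
  refine Finset.sum_congr rfl fun k _ => ?_
  field_simp

theorem cgoT_continuous (e : Fin 3 → Fin 3 → ℝ) (ω : ℝ) : Continuous (cgoT e ω) := by
  unfold cgoT; fun_prop

theorem cgoTi_contDiff (e : Fin 3 → Fin 3 → ℝ) (ω : ℝ) : ContDiff ℝ (⊤ : ℕ∞) (cgoTi e ω) := by
  unfold cgoTi; fun_prop

theorem cgoU_open (e : Fin 3 → Fin 3 → ℝ) (ω : ℝ) : IsOpen (cgoU e ω) :=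
  Metric.isOpen_ball.preimage (cgoT_continuous e ω)

theorem cgoU_large {e : Fin 3 → Fin 3 → ℝ} (he : cgoON e) {B : Set (Fin 3 → ℝ)} (hB : Bornology.IsBounded B) :
    ∃ ω, 0 < ω ∧ B ⊆ cgoU e ω := by
  obtain ⟨M, hM⟩ := hB.subset_closedBall 0
  have hpi := Real.pi_pos
  have hM1 : 0 < |M| + 1 := by positivity
  refine ⟨Real.pi / (4 * (|M| + 1)), by positivity, fun x hx => ?_⟩
  have hx' : ‖x‖ ≤ |M| := (mem_closedBall_zero_iff.1 (hM hx)).trans (le_abs_self M)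
  refine mem_ball_zero_iff.2 ?_
  rw [pi_norm_lt_iff (by norm_num)]
  intro i
  have he1 : ∀ k, |e i k| ≤ 1 := fun k => by
    have h1 := he i i
    simp only [if_true] at h1
    have h2 := Finset.single_le_sum (f := fun k => e i k * e i k) (fun k _ => mul_self_nonneg _) (Finset.mem_univ k)
    rw [h1] at h2
    rw [abs_le]
    constructor <;> nlinarith
  have h3 : |∑ k, e i k * x k| ≤ 3 * |M| := by
    calc _ ≤ ∑ k, |e i k * x k| := Finset.abs_sum_le_sum_abs _ _
      _ ≤ ∑ k : Fin 3, |M| := by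
          refine Finset.sum_le_sum fun k _ => ?_
          rw [abs_mul]
          calc _ ≤ 1 * |x k| := by gcongr; exact he1 k
            _ ≤ _ := by rw [one_mul]; exact (norm_le_pi_norm x k).trans hx'
      _ = _ := by simp
  unfold cgoT
  rw [Real.norm_eq_abs, abs_mul, abs_of_pos (by positivity)]
  calc _ ≤ Real.pi / (4 * (|M| + 1)) / (2 * Real.pi) * (3 * |M|) := by gcongr
    _ = (3 / 8) * (|M| / (|M| + 1)) := by field_simp; ring
    _ ≤ (3 / 8) * 1 := by
        gcongr
        rw [div_le_one hM1]
        linarith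
    _ < _ := by norm_num

theorem cgoChr_Fr (e : Fin 3 → Fin 3 → ℝ) (ω : ℝ) (θ : Fin 3 → ℝ) (n : Fin 3 → ℤ) (x : Fin 3 → ℝ) :
    cgoChr (cgoFr e ω θ n) x =
      Complex.exp (2 * Real.pi * Complex.I * ((∑ i, (n i : ℝ) * cgoT e ω x i : ℝ) : ℂ)) *
      Complex.exp (2 * Real.pi * Complex.I * ((∑ i, θ i * cgoT e ω x i : ℝ) : ℂ)) := by
  have hpi := Real.pi_pos
  have : ∑ j, cgoFr e ω θ n j * x j = 2 * Real.pi * ∑ i, ((n i : ℝ) * cgoT e ω x i + θ i * cgoT e ω x i) := by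
    unfold cgoFr cgoT
    simp only [Finset.sum_mul, Finset.mul_sum]
    rw [Finset.sum_comm]
    refine Finset.sum_congr rfl fun i _ => ?_
    rw [← Finset.sum_add_distrib, Finset.mul_sum]
    refine Finset.sum_congr rfl fun k _ => ?_
    field_simp
  rw [← Complex.exp_add, ← mul_add, ← Complex.ofReal_add, ← Finset.sum_add_distrib]
  unfold cgoChr
  rw [this]
  congr 1
  push_cast
  ring

theorem cgo_repr {e : Fin 3 → Fin 3 → ℝ} (he : cgoON e) {ω : ℝ} (hω : 0 < ω) (θ : Fin 3 → ℝ)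
    {h : (Fin 3 → ℝ) → ℂ} (hh : ContDiff ℝ (⊤ : ℕ∞) h) (hs : tsupport h ⊆ cgoU e ω) :
    ∃ p, cgoRD p ∧ ∀ x ∈ cgoU e ω, h x = cgoS (cgoFr e ω θ) p x := by
  let H : (Fin 3 → ℝ) → ℂ := fun y => h (cgoTi e ω y) *
    Complex.exp (-(2 * Real.pi * Complex.I * ((∑ i, θ i * y i : ℝ) : ℂ)))
  have hH : ContDiff ℝ (⊤ : ℕ∞) H := by
    refine (hh.comp (cgoTi_contDiff e ω)).mul ?_
    have h0 : ContDiff ℝ (⊤ : ℕ∞) fun y : Fin 3 → ℝ => (∑ i, θ i * y i : ℝ) := by fun_prop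
    have : ContDiff ℝ (⊤ : ℕ∞) fun y : Fin 3 → ℝ => ((∑ i, θ i * y i : ℝ) : ℂ) :=
      Complex.ofRealCLM.contDiff.comp h0
    exact ((contDiff_const.mul this).neg).cexp
  have hsub : tsupport H ⊆ Metric.ball 0 (1 / 2) := by
    have h1 : tsupport H ⊆ cgoTi e ω ⁻¹' tsupport h := by
      refine closure_minimal (fun y hy => ?_)
        ((isClosed_tsupport h).preimage (cgoTi_contDiff e ω).continuous)
      refine subset_tsupport h ?_
      rw [Function.mem_support] at hy ⊢
      exact left_ne_zero_of_mul hy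
    intro y hy
    have := hs (h1 hy)
    simpa only [cgoU, Set.mem_ofPred_eq, cgoT_Ti he hω] using this
  obtain ⟨p, hp, hp2⟩ := cgo_fourier H hH hsub
  refine ⟨p, hp, fun x hx => ?_⟩
  have h2 := (hp2 _ hx).mul_right (Complex.exp (2 * Real.pi * Complex.I * ((∑ i, θ i * cgoT e ω x i : ℝ) : ℂ)))
  have h3 : H (cgoT e ω x) * (Complex.exp (2 * Real.pi * Complex.I * ((∑ i, θ i * cgoT e ω x i : ℝ) : ℂ))) = h x := by
    simp only [H, cgoTi_T he hω]
    rw [mul_assoc, ← Complex.exp_add]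
    simp
  rw [h3] at h2
  rw [← h2.tsum_eq]
  unfold cgoS
  simp only [cgoChr_Fr, mul_assoc]

theorem cgo_inj {e : Fin 3 → Fin 3 → ℝ} (he : cgoON e) {ω : ℝ} (hω : 0 < ω) (θ : Fin 3 → ℝ)
    {c : (Fin 3 → ℤ) → ℂ} (hc : cgoRD c) (h : ∀ x ∈ cgoU e ω, cgoS (cgoFr e ω θ) c x = 0) : ∀ n, c n = 0 := by
  refine cgo_fourier_inj hc fun y hy => ?_
  have h1 := h (cgoTi e ω y) (by simpa only [cgoU, Set.mem_ofPred_eq, cgoT_Ti he hω] using hy)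
  unfold cgoS at h1
  simp only [cgoChr_Fr, ← mul_assoc, tsum_mul_right, cgoT_Ti he hω] at h1
  exact (mul_eq_zero.1 h1).resolve_right (Complex.exp_ne_zero _)

theorem cgo_sym_eq {e : Fin 3 → Fin 3 → ℝ} (he : cgoON e) (ω : ℝ) (θ : Fin 3 → ℝ) (τ κ : ℝ) (n : Fin 3 → ℤ) :
    ∑ j, ((cgoFr e ω θ n j : ℂ) ^ 2 + 2 * mxZeta τ κ (e 0) (e 1) j * (cgoFr e ω θ n j : ℂ)) =
      ((ω ^ 2 * ∑ i, (n i + θ i) ^ 2 + 2 * ω * Real.sqrt (τ ^ 2 + κ ^ 2) * (n 1 + θ 1) : ℝ) : ℂ)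
      + ((-(2 * ω * τ * (n 0 + θ 0)) : ℝ) : ℂ) * Complex.I := by
  have h1 : ∀ i, ∑ j, cgoFr e ω θ n j * e i j = ω * (n i + θ i) := fun i => by
    calc _ = ω * ∑ l, (n l + θ l) * ∑ j, e l j * e i j := by
          unfold cgoFr
          simp only [Finset.mul_sum, Finset.sum_mul]
          rw [Finset.sum_comm]
          simp only [mul_assoc]
      _ = _ := by simp [fun l => he l i]
  have h2 : ∑ j, cgoFr e ω θ n j ^ 2 = ω ^ 2 * ∑ i, (n i + θ i) ^ 2 := by
    calc _ = ∑ i, ω * (n i + θ i) * ∑ j, cgoFr e ω θ n j * e i j := by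
          simp only [Finset.mul_sum]
          rw [Finset.sum_comm]
          refine Finset.sum_congr rfl fun j _ => ?_
          rw [sq]
          conv_lhs => lhs; unfold cgoFr
          rw [Finset.mul_sum, Finset.sum_mul]
          refine Finset.sum_congr rfl fun i _ => ?_
          ring
      _ = _ := by
          simp only [h1, Finset.mul_sum]
          refine Finset.sum_congr rfl fun i _ => ?_
          ring
  have h3 := h1 0
  have h4 := h1 1
  have h5 : ∑ j, ((cgoFr e ω θ n j : ℂ) ^ 2 + 2 * mxZeta τ κ (e 0) (e 1) j * (cgoFr e ω θ n j : ℂ)) =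
      ((∑ j, cgoFr e ω θ n j ^ 2 : ℝ) : ℂ) + 2 * Real.sqrt (τ ^ 2 + κ ^ 2) * ((∑ j, cgoFr e ω θ n j * e 1 j : ℝ) : ℂ)
      - 2 * τ * ((∑ j, cgoFr e ω θ n j * e 0 j : ℝ) : ℂ) * Complex.I := by
    push_cast
    simp only [Fin.sum_univ_three, mxZeta]
    ring
  rw [h5, h2, h3, h4]
  push_cast
  ring

theorem cgo_sym_bound {e : Fin 3 → Fin 3 → ℝ} (he : cgoON e) {ω : ℝ} (hω : 0 < ω) {τ κ : ℝ} (hτ : 1 ≤ τ)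
    (hκ0 : 0 ≤ κ) (hκ : κ ≤ τ) (n : Fin 3 → ℤ) {m : ℂ}
    (hm : m = ∑ j, ((cgoFr e ω ![1 / 2, 0, 0] n j : ℂ) ^ 2 +
      2 * mxZeta τ κ (e 0) (e 1) j * (cgoFr e ω ![1 / 2, 0, 0] n j : ℂ))) :
    τ * ω ≤ ‖m‖ ∧ cgoWt n ≤ 4 * (1 / ω + 8 / ω ^ 2) * ‖m‖ := by
  rw [cgo_sym_eq he] at hm
  set t := Real.sqrt (τ ^ 2 + κ ^ 2) with ht
  have ht0 : 0 ≤ t := Real.sqrt_nonneg _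
  have ht2 : t ≤ 2 * τ := by
    rw [ht, Real.sqrt_le_left (by linarith)]
    nlinarith
  have hre : m.re = ω ^ 2 * ∑ i, (n i + (![1 / 2, 0, 0] : Fin 3 → ℝ) i) ^ 2 + 2 * ω * t * (n 1 + (![1 / 2, 0, 0] : Fin 3 → ℝ) 1) := by
    rw [hm, Complex.add_re, Complex.ofReal_re, Complex.re_ofReal_mul]; simp
  have him : m.im = -(2 * ω * τ * (n 0 + (![1 / 2, 0, 0] : Fin 3 → ℝ) 0)) := by
    rw [hm, Complex.add_im, Complex.ofReal_im, Complex.im_ofReal_mul]; simp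
  set N := Real.sqrt (∑ i, (n i + (![1 / 2, 0, 0] : Fin 3 → ℝ) i) ^ 2) with hN
  have hS0 : 0 ≤ ∑ i, (n i + (![1 / 2, 0, 0] : Fin 3 → ℝ) i) ^ 2 := Finset.sum_nonneg fun i _ => sq_nonneg _
  have hN2 : N ^ 2 = ∑ i, (n i + (![1 / 2, 0, 0] : Fin 3 → ℝ) i) ^ 2 := Real.sq_sqrt hS0
  have hN0 : 0 ≤ N := Real.sqrt_nonneg _
  have hNi : ∀ i, |n i + (![1 / 2, 0, 0] : Fin 3 → ℝ) i| ≤ N := fun i => by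
    rw [hN]
    refine Real.le_sqrt_of_sq_le ?_
    rw [sq_abs]
    exact Finset.single_le_sum (f := fun i => (n i + (![1 / 2, 0, 0] : Fin 3 → ℝ) i) ^ 2) (fun i _ => sq_nonneg _)
      (Finset.mem_univ i)
  have hhalf : 1 / 2 ≤ |(n 0 : ℝ) + (![1 / 2, 0, 0] : Fin 3 → ℝ) 0| := by
    simp only [Matrix.cons_val_zero]
    rcases le_or_gt 0 (n 0) with h | h
    · have : (0 : ℝ) ≤ n 0 := by exact_mod_cast h
      rw [abs_of_nonneg (by linarith)]
      linarith
    · have h' : n 0 ≤ -1 := by omega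
      have : (n 0 : ℝ) ≤ -1 := by exact_mod_cast h'
      rw [abs_of_nonpos (by linarith)]
      linarith
  have hNh : 1 / 2 ≤ N := hhalf.trans (hNi 0)
  have hm1 : τ * ω ≤ ‖m‖ := by
    refine le_trans ?_ (Complex.abs_im_le_norm m)
    rw [him, abs_neg, abs_mul, abs_of_pos (by positivity)]
    have h := mul_le_mul_of_nonneg_left hhalf (show 0 ≤ 2 * ω * τ by positivity)
    linarith
  refine ⟨hm1, ?_⟩
  have hw : cgoWt n ≤ 4 * N := by
    have : ‖n‖ ≤ N + 1 / 2 := by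
      refine (pi_norm_le_iff_of_nonneg (by linarith)).2 fun i => ?_
      rw [Int.norm_eq_abs]
      have h1 := hNi i
      have h2 : |(![1 / 2, 0, 0] : Fin 3 → ℝ) i| ≤ 1 / 2 := by
        fin_cases i <;> simp [abs_of_pos]
      have h3 := abs_sub (n i + (![1 / 2, 0, 0] : Fin 3 → ℝ) i) ((![1 / 2, 0, 0] : Fin 3 → ℝ) i)
      rw [add_sub_cancel_right] at h3
      linarith
    unfold cgoWt
    linarith
  have hNm : N ≤ (1 / ω + 8 / ω ^ 2) * ‖m‖ := by
    rcases le_or_gt (8 * τ) (ω * N) with h | h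
    · have h1 : ω * N ≤ ‖m‖ := by
        refine le_trans ?_ ((le_abs_self _).trans (Complex.abs_re_le_norm m))
        rw [hre, ← hN2]
        have h2 := (abs_le.1 (hNi 1)).1
        have h3 : 2 * ω * t * (n 1 + (![1 / 2, 0, 0] : Fin 3 → ℝ) 1) ≥ 2 * ω * t * (-N) := by
          gcongr
        have h4 : 2 * ω * t * N ≤ 2 * ω * (2 * τ) * N := by gcongr
        have h5 : (ω * N) * (8 * τ) ≤ (ω * N) * (ω * N) := by gcongr
        have h6 : (ω * N) * 1 ≤ (ω * N) * τ := by gcongr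
        nlinarith
      calc N = 1 / ω * (ω * N) := by field_simp
        _ ≤ 1 / ω * ‖m‖ := by gcongr
        _ ≤ _ := by
          gcongr
          have : 0 ≤ 8 / ω ^ 2 := by positivity
          linarith
    · have h1 : ω ^ 2 / 8 * N ≤ ‖m‖ := by
        refine le_trans ?_ hm1
        nlinarith
      calc N = 8 / ω ^ 2 * (ω ^ 2 / 8 * N) := by field_simp
        _ ≤ 8 / ω ^ 2 * ‖m‖ := by gcongr
        _ ≤ _ := by
          gcongr
          have : 0 ≤ 1 / ω := by positivity
          linarith
  linarith


abbrev cgoSm (f : (Fin 3 → ℝ) → ℂ) : Prop := ContDiff ℝ (⊤ : ℕ∞) f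

theorem cgoSm.diff {f : (Fin 3 → ℝ) → ℂ} (hf : cgoSm f) (x : Fin 3 → ℝ) : DifferentiableAt ℝ f x :=
  (ContDiff.differentiable hf (by simp)).differentiableAt

theorem cgoSm.pd {f : (Fin 3 → ℝ) → ℂ} (hf : cgoSm f) (j : Fin 3) : cgoSm (pdC f j) := by
  have : ContDiff ℝ (⊤ : ℕ∞) (fderiv ℝ f) := ContDiff.fderiv_right hf (by simp)
  exact this.clm_apply contDiff_const

theorem pdC_add {f g : (Fin 3 → ℝ) → ℂ} (hf : cgoSm f) (hg : cgoSm g) (j : Fin 3) (x : Fin 3 → ℝ) :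
    pdC (fun y => f y + g y) j x = pdC f j x + pdC g j x := by
  unfold pdC
  rw [fderiv_fun_add (hf.diff x) (hg.diff x)]
  rfl

theorem pdC_sub {f g : (Fin 3 → ℝ) → ℂ} (hf : cgoSm f) (hg : cgoSm g) (j : Fin 3) (x : Fin 3 → ℝ) :
    pdC (fun y => f y - g y) j x = pdC f j x - pdC g j x := by
  unfold pdC
  rw [fderiv_fun_sub (hf.diff x) (hg.diff x)]
  rfl

theorem pdC_mul {f g : (Fin 3 → ℝ) → ℂ} (hf : cgoSm f) (hg : cgoSm g) (j : Fin 3) (x : Fin 3 → ℝ) :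
    pdC (fun y => f y * g y) j x = pdC f j x * g x + f x * pdC g j x := by
  unfold pdC
  rw [fderiv_fun_mul (hf.diff x) (hg.diff x)]
  simp
  ring

theorem pdC_const (z : ℂ) (j : Fin 3) (x : Fin 3 → ℝ) : pdC (fun _ => z) j x = 0 := by
  unfold pdC
  simp

theorem pdC_const_mul {g : (Fin 3 → ℝ) → ℂ} (z : ℂ) (hg : cgoSm g) (j : Fin 3) (x : Fin 3 → ℝ) :
    pdC (fun y => z * g y) j x = z * pdC g j x := by
  rw [pdC_mul contDiff_const hg, pdC_const]
  ring

theorem pdC_const_add {g : (Fin 3 → ℝ) → ℂ} (z : ℂ) (hg : cgoSm g) (j : Fin 3) (x : Fin 3 → ℝ) :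
    pdC (fun y => z + g y) j x = pdC g j x := by
  rw [pdC_add contDiff_const hg, pdC_const]
  ring

theorem pdC_sum {f : Fin 3 → (Fin 3 → ℝ) → ℂ} (hf : ∀ i, cgoSm (f i)) (j : Fin 3) (x : Fin 3 → ℝ) :
    pdC (fun y => ∑ i, f i y) j x = ∑ i, pdC (f i) j x := by
  simp only [Fin.sum_univ_three]
  rw [pdC_add ((hf 0).add (hf 1)) (hf 2), pdC_add (hf 0) (hf 1)]

theorem pdC_congr {U : Set (Fin 3 → ℝ)} (hU : IsOpen U) {f g : (Fin 3 → ℝ) → ℂ} (h : ∀ x ∈ U, f x = g x)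
    (j : Fin 3) {x : Fin 3 → ℝ} (hx : x ∈ U) : pdC f j x = pdC g j x := by
  unfold pdC
  have : f =ᶠ[nhds x] g := by
    filter_upwards [hU.mem_nhds hx] with y hy using h y hy
  rw [this.fderiv_eq]

theorem pdC_comm {f : (Fin 3 → ℝ) → ℂ} (hf : cgoSm f) (i j : Fin 3) (x : Fin 3 → ℝ) :
    pdC (pdC f i) j x = pdC (pdC f j) i x := by
  have h1 : ∀ i j, pdC (pdC f i) j x = fderiv ℝ (fderiv ℝ f) x (Pi.single j 1) (Pi.single i 1) := fun i j => by
    have h2 : ContDiff ℝ (⊤ : ℕ∞) (fderiv ℝ f) := ContDiff.fderiv_right hf (by simp)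
    have h3 : DifferentiableAt ℝ (fderiv ℝ f) x := (h2.differentiable (by simp)).differentiableAt
    change fderiv ℝ (fun y => fderiv ℝ f y (Pi.single i 1)) x (Pi.single j 1) = _
    rw [fderiv_clm_apply h3 (differentiableAt_const _)]
    simp
  rw [h1, h1]
  have h4 : IsSymmSndFDerivAt ℝ f x := by
    refine (ContDiff.contDiffAt hf).isSymmSndFDerivAt ?_
    simp only [minSmoothness_of_isRCLikeNormedField]
    exact WithTop.coe_le_coe.2 (le_top : (2 : ℕ∞) ≤ ⊤)
  exact h4 _ _

noncomputable def cgoLap (f : (Fin 3 → ℝ) → ℂ) (x : Fin 3 → ℝ) : ℂ := ∑ j, pdC (pdC f j) j x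

theorem cgoSm.lap {f : (Fin 3 → ℝ) → ℂ} (hf : cgoSm f) : cgoSm (cgoLap f) :=
  ContDiff.sum fun j _ => (hf.pd j).pd j

theorem cgoLap_mul {f g : (Fin 3 → ℝ) → ℂ} (hf : cgoSm f) (hg : cgoSm g) (x : Fin 3 → ℝ) :
    cgoLap (fun y => f y * g y) x = cgoLap f x * g x + 2 * (∑ j, pdC f j x * pdC g j x) + f x * cgoLap g x := by
  unfold cgoLap
  have h1 : ∀ j, pdC (pdC (fun y => f y * g y) j) j x =
      pdC (pdC f j) j x * g x + 2 * (pdC f j x * pdC g j x) + f x * pdC (pdC g j) j x := fun j => by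
    have : pdC (fun y => f y * g y) j = fun x => pdC f j x * g x + f x * pdC g j x := funext fun x => pdC_mul hf hg j x
    rw [this, pdC_add ((hf.pd j).mul hg) (hf.mul (hg.pd j)), pdC_mul (hf.pd j) hg, pdC_mul hf (hg.pd j)]
    ring
  simp only [h1, Finset.sum_add_distrib, Finset.sum_mul, Finset.mul_sum]

theorem cgoLap_sub {f g : (Fin 3 → ℝ) → ℂ} (hf : cgoSm f) (hg : cgoSm g) (x : Fin 3 → ℝ) :
    cgoLap (fun y => f y - g y) x = cgoLap f x - cgoLap g x := by
  unfold cgoLap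
  rw [← Finset.sum_sub_distrib]
  refine Finset.sum_congr rfl fun j _ => ?_
  have : pdC (fun y => f y - g y) j = fun x => pdC f j x - pdC g j x := funext fun x => pdC_sub hf hg j x
  rw [this, pdC_sub (hf.pd j) (hg.pd j)]

theorem cgoLap_const_mul {g : (Fin 3 → ℝ) → ℂ} (z : ℂ) (hg : cgoSm g) (x : Fin 3 → ℝ) :
    cgoLap (fun y => z * g y) x = z * cgoLap g x := by
  rw [cgoLap_mul contDiff_const hg]
  have : ∀ j, pdC (fun _ : Fin 3 → ℝ => z) j = fun _ => 0 := fun j => funext fun x => pdC_const z j x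
  simp [cgoLap, this, pdC_const]

theorem cgoLap_congr {U : Set (Fin 3 → ℝ)} (hU : IsOpen U) {f g : (Fin 3 → ℝ) → ℂ} (h : ∀ x ∈ U, f x = g x)
    {x : Fin 3 → ℝ} (hx : x ∈ U) : cgoLap f x = cgoLap g x := by
  unfold cgoLap
  refine Finset.sum_congr rfl fun j _ => ?_
  exact pdC_congr hU (fun y hy => pdC_congr hU h j hy) j hx

theorem cgoLap_sum_pd {A : Fin 3 → (Fin 3 → ℝ) → ℂ} (hA : ∀ i, cgoSm (A i)) (x : Fin 3 → ℝ) :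
    cgoLap (fun y => ∑ i, pdC (A i) i y) x = ∑ i, pdC (cgoLap (A i)) i x := by
  unfold cgoLap
  have h1 : ∀ j, pdC (fun y => ∑ i, pdC (A i) i y) j = fun x => ∑ i, pdC (pdC (A i) i) j x :=
    fun j => funext fun x => pdC_sum (fun i => (hA i).pd i) j x
  have h2 : ∀ i, pdC (fun y => ∑ j, pdC (pdC (A i) j) j y) i x = ∑ j, pdC (pdC (pdC (A i) j) j) i x :=
    fun i => pdC_sum (fun j => ((hA i).pd j).pd j) i x
  simp only [h1, h2]
  rw [Finset.sum_comm' (t' := Finset.univ) (s' := fun _ => Finset.univ) (by simp)]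
  have h3 : ∀ j, pdC (fun x => ∑ i, pdC (pdC (A i) i) j x) j x = ∑ i, pdC (pdC (pdC (A i) i) j) j x :=
    fun j => pdC_sum (fun i => ((hA i).pd i).pd j) j x
  simp only [h3]
  refine Finset.sum_congr rfl fun j _ => Finset.sum_congr rfl fun i _ => ?_
  have h4 : pdC (pdC (A i) i) j = pdC (pdC (A i) j) i := funext fun x => pdC_comm (hA i) i j x
  rw [h4, pdC_comm ((hA i).pd j) i j]

theorem cgo_gauge {U : Set (Fin 3 → ℝ)} (hU : IsOpen U) {s f : (Fin 3 → ℝ) → ℂ} {A : Fin 3 → (Fin 3 → ℝ) → ℂ}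
    (hs : cgoSm s) (hf : cgoSm f) (hA : ∀ i, cgoSm (A i)) (κ : ℂ)
    (eA : ∀ x ∈ U, ∀ j, cgoLap (A j) x = 2 * κ ^ 2 * (f x * pdC s j x) - κ ^ 2 * (s x * s x * A j x))
    (ef : ∀ x ∈ U, s x * cgoLap f x = cgoLap s x * f x - 2 * s x * (∑ j, pdC s j x * A j x) - κ ^ 2 * s x ^ 3 * f x)
    {x : Fin 3 → ℝ} (hx : x ∈ U) :
    cgoLap (fun y => (∑ j, pdC (A j) j y) - κ ^ 2 * (s y * f y)) x =
      - (κ ^ 2 * s x ^ 2 * ((∑ j, pdC (A j) j x) - κ ^ 2 * (s x * f x))) := by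
  rw [cgoLap_sub (ContDiff.sum fun j _ => (hA j).pd j) (contDiff_const.mul (hs.mul hf)), cgoLap_sum_pd hA,
    cgoLap_const_mul _ (hs.mul hf), cgoLap_mul hs hf]
  have h1 : ∀ j, pdC (cgoLap (A j)) j x = 2 * κ ^ 2 * (pdC f j x * pdC s j x + f x * pdC (pdC s j) j x)
      - κ ^ 2 * ((2 * s x * pdC s j x) * A j x + s x * s x * pdC (A j) j x) := fun j => by
    rw [pdC_congr hU (fun y hy => eA y hy j) j hx,
      pdC_sub (contDiff_const.mul (hf.mul (hs.pd j))) (contDiff_const.mul ((hs.mul hs).mul (hA j))),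
      pdC_const_mul _ (hf.mul (hs.pd j)), pdC_const_mul _ ((hs.mul hs).mul (hA j)), pdC_mul hf (hs.pd j),
      pdC_mul (hs.mul hs) (hA j), pdC_mul hs hs]
    ring
  have h2 := ef x hx
  simp only [h1]
  rw [h2]
  simp only [cgoLap, Fin.sum_univ_three]
  ring

theorem cgo_curlcurl {U : Set (Fin 3 → ℝ)} (hU : IsOpen U) {s si f : (Fin 3 → ℝ) → ℂ} {A : Fin 3 → (Fin 3 → ℝ) → ℂ}
    (hs : cgoSm s) (hsi : cgoSm si) (hssi : ∀ x, s x * si x = 1) (hf : cgoSm f) (hA : ∀ i, cgoSm (A i)) (κ : ℂ)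
    (eA : ∀ x ∈ U, ∀ j, cgoLap (A j) x = 2 * κ ^ 2 * (f x * pdC s j x) - κ ^ 2 * (s x * s x * A j x))
    (hg : ∀ x ∈ U, (∑ j, pdC (A j) j x) = κ ^ 2 * (s x * f x))
    {E : (Fin 3 → ℝ) → Fin 3 → ℂ} (hE : ∀ y j, E y j = A j y + pdC (fun y => f y * si y) j y)
    {x : Fin 3 → ℝ} (hx : x ∈ U) (i : Fin 3) :
    curlC (fun y => curlC E y) x i = κ ^ 2 * s x ^ 2 * E x i := by
  have hv : cgoSm fun y => f y * si y := hf.mul hsi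
  have hEj : ∀ j, (fun y => E y j) = fun y => A j y + pdC (fun y => f y * si y) j y := fun j => funext fun y => hE y j
  have hpE : ∀ i j y, pdC (fun y => E y j) i y = pdC (A j) i y + pdC (pdC (fun y => f y * si y) j) i y := fun i j y => by
    rw [hEj, pdC_add (hA j) (hv.pd j)]
  have hc := pdC_comm hv
  have h1 : ∀ y, curlC E y = ![pdC (A 2) 1 y - pdC (A 1) 2 y, pdC (A 0) 2 y - pdC (A 2) 0 y,
      pdC (A 1) 0 y - pdC (A 0) 1 y] := fun y => by
    unfold curlC
    simp only [hpE, hc 2 1, hc 2 0, hc 1 0]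
    simp
  have h2 : ∀ i, κ ^ 2 * s x ^ 2 * E x i = ∑ j, pdC (pdC (A j) i) j x - cgoLap (A i) x := fun i => by
    have h3 : ∑ j, pdC (pdC (A j) i) j x = κ ^ 2 * (pdC s i x * f x + s x * pdC f i x) := by
      rw [← pdC_mul hs hf, ← pdC_const_mul _ (hs.mul hf), ← pdC_congr hU hg i hx, pdC_sum (fun j => (hA j).pd j)]
      exact Finset.sum_congr rfl fun j _ => pdC_comm (hA j) i j x
    have h4 : pdC s i x * si x + s x * pdC si i x = 0 := by
      rw [← pdC_mul hs hsi]
      simp only [hssi, pdC_const]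
    rw [h3, eA x hx, hE, pdC_mul hf hsi]
    have h5 := hssi x
    linear_combination (κ ^ 2 * s x * pdC f i x - κ ^ 2 * f x * pdC s i x) * h5 + (κ ^ 2 * s x * f x) * h4
  rw [h2]
  unfold curlC at h1 ⊢
  simp only [h1]
  simp only [cgoLap, Fin.sum_univ_three]
  fin_cases i
  · simp only [Matrix.cons_val]
    simp
    rw [pdC_sub ((hA 1).pd 0) ((hA 0).pd 1), pdC_sub ((hA 0).pd 2) ((hA 2).pd 0)]
    ring
  · simp only [Matrix.cons_val]
    simp
    rw [pdC_sub ((hA 2).pd 1) ((hA 1).pd 2), pdC_sub ((hA 1).pd 0) ((hA 0).pd 1)]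
    ring
  · simp only [Matrix.cons_val]
    simp
    rw [pdC_sub ((hA 0).pd 2) ((hA 2).pd 0), pdC_sub ((hA 2).pd 1) ((hA 1).pd 2)]
    ring


noncomputable def cgoL (ζ : Fin 3 → ℂ) (u : (Fin 3 → ℝ) → ℂ) (x : Fin 3 → ℝ) : ℂ :=
  ∑ j, (pdC (pdC u j) j x + 2 * Complex.I * ζ j * pdC u j x)

theorem cgoL_congr {U : Set (Fin 3 → ℝ)} (hU : IsOpen U) (ζ : Fin 3 → ℂ) {f g : (Fin 3 → ℝ) → ℂ}
    (h : ∀ x ∈ U, f x = g x) {x : Fin 3 → ℝ} (hx : x ∈ U) : cgoL ζ f x = cgoL ζ g x := by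
  unfold cgoL
  refine Finset.sum_congr rfl fun j _ => ?_
  rw [pdC_congr hU (fun y hy => pdC_congr hU h j hy) j hx, pdC_congr hU h j hx]

theorem cgoRD.sum {ι : Type} [Fintype ι] {c : ι → (Fin 3 → ℤ) → ℂ} (hc : ∀ a, cgoRD (c a)) :
    cgoRD fun n => ∑ a, c a n := by
  intro N
  refine Summable.of_nonneg_of_le (fun n => ?_) (fun n => ?_) (summable_sum (s := Finset.univ) fun a _ => hc a N)
  · have := cgoWt_pos n; positivity
  · have := cgoWt_pos n
    rw [← Finset.mul_sum]
    gcongr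
    exact norm_sum_le _ _

theorem cgoS_sum {ι : Type} [Fintype ι] {ξ : (Fin 3 → ℤ) → Fin 3 → ℝ} {c : ι → (Fin 3 → ℤ) → ℂ}
    (hc : ∀ a, cgoRD (c a)) (x : Fin 3 → ℝ) :
    cgoS ξ (fun n => ∑ a, c a n) x = ∑ a, cgoS ξ (c a) x := by
  unfold cgoS
  rw [← Summable.tsum_finsetSum fun a _ => cgoS_summable (hc a).summable_norm x]
  simp only [Finset.sum_mul]

theorem cgoL_S {ξ : (Fin 3 → ℤ) → Fin 3 → ℝ} (hξ : cgoPB ξ) (ζ : Fin 3 → ℂ) {c : (Fin 3 → ℤ) → ℂ} (hc : cgoRD c)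
    (x : Fin 3 → ℝ) :
    cgoL ζ (cgoS ξ c) x = cgoS ξ (fun n => -(∑ j, ((ξ n j : ℂ) ^ 2 + 2 * ζ j * (ξ n j : ℂ))) * c n) x := by
  have h1 : ∀ j, pdC (cgoS ξ c) j = cgoS ξ (cgoD ξ j c) := fun j => funext fun x => cgoS_pdC hξ hc j x
  unfold cgoL
  simp only [h1]
  have h2 : ∀ j, pdC (cgoS ξ (cgoD ξ j c)) j x = cgoS ξ (cgoD ξ j (cgoD ξ j c)) x := fun j =>
    cgoS_pdC hξ (hc.D hξ j) j x
  simp only [h2, ← cgoS_const_mul]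
  have h3 : ∀ j, cgoS ξ (cgoD ξ j (cgoD ξ j c)) x + cgoS ξ (fun n => 2 * Complex.I * ζ j * cgoD ξ j c n) x =
      cgoS ξ (fun n => cgoD ξ j (cgoD ξ j c) n + 2 * Complex.I * ζ j * cgoD ξ j c n) x := fun j =>
    (cgoS_add ((hc.D hξ j).D hξ j) ((hc.D hξ j).const_mul _) x).symm
  simp only [h3]
  rw [← cgoS_sum fun j => ((hc.D hξ j).D hξ j).add ((hc.D hξ j).const_mul _)]
  congr 1
  funext n
  simp only [cgoD, Fin.sum_univ_three]
  linear_combination ((ξ n 0 : ℂ) ^ 2 + 2 * ζ 0 * (ξ n 0 : ℂ) + ((ξ n 1 : ℂ) ^ 2 + 2 * ζ 1 * (ξ n 1 : ℂ)) +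
    ((ξ n 2 : ℂ) ^ 2 + 2 * ζ 2 * (ξ n 2 : ℂ))) * c n * Complex.I_sq

theorem cgoFr_shift (e : Fin 3 → Fin 3 → ℝ) (ω : ℝ) (θ : Fin 3 → ℝ) (n m : Fin 3 → ℤ) :
    cgoFr e ω θ n = fun j => cgoFr e ω 0 (n - m) j + cgoFr e ω θ m j := by
  funext j
  unfold cgoFr
  rw [← mul_add, ← Finset.sum_add_distrib]
  congr 1
  refine Finset.sum_congr rfl fun i _ => ?_
  simp
  ring

/-- the shifted frequencies -/
noncomputable def cgoXi (e : Fin 3 → Fin 3 → ℝ) (ω : ℝ) : (Fin 3 → ℤ) → Fin 3 → ℝ := cgoFr e ω ![1 / 2, 0, 0]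

theorem cgoXi_shift (e : Fin 3 → Fin 3 → ℝ) (ω : ℝ) (n m : Fin 3 → ℤ) :
    cgoXi e ω n = fun j => cgoFr e ω 0 (n - m) j + cgoXi e ω m j := cgoFr_shift e ω ![1 / 2, 0, 0] n m

theorem cgo_solve_fun {ι : Type} [Fintype ι] {e : Fin 3 → Fin 3 → ℝ} (he : cgoON e) {ω : ℝ} (hω : 0 < ω)
    {κ : ℝ} (hκ : 0 < κ) {P : ι → ι → (Fin 3 → ℝ) → ℂ} (hP : ∀ a b, cgoSm (P a b))
    (hPs : ∀ a b, tsupport (P a b) ⊆ cgoU e ω) {M : ℝ} (hM : 0 ≤ M) :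
    ∃ C τ₀ : ℝ, ∀ τ, τ₀ ≤ τ → ∀ c₀ : ι → ℂ, (∀ b, ‖c₀ b‖ ≤ M) →
      ∃ c : ι → (Fin 3 → ℤ) → ℂ, (∀ a, cgoRD (c a)) ∧
        (∀ a, ∀ x ∈ cgoU e ω, cgoL (mxZeta τ κ (e 0) (e 1)) (cgoS (cgoXi e ω) (c a)) x =
          ∑ b, P a b x * (c₀ b + cgoS (cgoXi e ω) (c b) x)) ∧
        (∀ a x, τ * ‖cgoS (cgoXi e ω) (c a) x‖ ≤ C) ∧
        (∀ a j x, ‖pdC (cgoS (cgoXi e ω) (c a)) j x‖ ≤ C) := by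
  choose p hp hp2 using fun a b => cgo_repr he hω 0 (hP a b) (hPs a b)
  choose q hq hq2 using fun a b => cgo_repr he hω ![1 / 2, 0, 0] (hP a b) (hPs a b)
  obtain ⟨Kx, hKx, hKx2⟩ := cgoFr_PB e ω ![1 / 2, 0, 0]
  have hpb : cgoPB (cgoXi e ω) := cgoFr_PB e ω ![1 / 2, 0, 0]
  set B := ∑ b, ∑ a, ∑' n, ‖p a b n‖ with hBd
  set Q := ∑ a, ∑ b, ∑' n, ‖q a b n‖ with hQd
  have hnn : ∀ f : (Fin 3 → ℤ) → ℂ, 0 ≤ ∑' n, ‖f n‖ := fun f => tsum_nonneg fun n => norm_nonneg _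
  have hB0 : 0 ≤ B := Finset.sum_nonneg fun b _ => Finset.sum_nonneg fun a _ => hnn _
  have hQ0 : 0 ≤ Q := Finset.sum_nonneg fun b _ => Finset.sum_nonneg fun a _ => hnn _
  have hB : ∀ b, ∑ a, ∑' n, ‖p a b n‖ ≤ B := fun b =>
    Finset.single_le_sum (f := fun b => ∑ a, ∑' n, ‖p a b n‖)
      (fun b _ => Finset.sum_nonneg fun a _ => hnn _) (Finset.mem_univ b)
  set K := 4 * (1 / ω + 8 / ω ^ 2) with hK
  have hK0 : 0 ≤ K := by positivity
  refine ⟨2 / ω * (M * Q) + Kx * (2 * K * (M * Q)), max 1 (max κ (2 * B / ω)), fun τ hτ c₀ hc₀ => ?_⟩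
  have hτ1 : 1 ≤ τ := (le_max_left _ _).trans hτ
  have hτκ : κ ≤ τ := ((le_max_left _ _).trans (le_max_right _ _)).trans hτ
  have hτB : 2 * B / ω ≤ τ := ((le_max_right _ _).trans (le_max_right _ _)).trans hτ
  have hτ0 : 0 < τ := by linarith
  set ζ := mxZeta τ κ (e 0) (e 1) with hζ
  set m : (Fin 3 → ℤ) → ℂ := fun n => ∑ j, ((cgoXi e ω n j : ℂ) ^ 2 + 2 * ζ j * (cgoXi e ω n j : ℂ)) with hm
  have hmb := fun n => cgo_sym_bound he hω hτ1 hκ.le hτκ n (m := m n) rfl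
  have hmpos : ∀ n, 0 < ‖m n‖ := fun n => lt_of_lt_of_le (by positivity) (hmb n).1
  set r : ι → (Fin 3 → ℤ) → ℂ := fun a n => ∑ b, c₀ b * q a b n with hr
  have hrRD : ∀ a, cgoRD (r a) := fun a => cgoRD.sum fun b => (hq a b).const_mul _
  have hrQ : ∑ a, ∑' n, ‖r a n‖ ≤ M * Q := by
    rw [hQd, Finset.mul_sum]
    refine Finset.sum_le_sum fun a _ => ?_
    rw [Finset.mul_sum]
    simp only [← tsum_mul_left]
    rw [← Summable.tsum_finsetSum fun b _ => (hq a b).summable_norm.mul_left M]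
    refine (hrRD a).summable_norm.tsum_le_tsum (fun n => ?_)
      (summable_sum fun b _ => (hq a b).summable_norm.mul_left M)
    refine (norm_sum_le _ _).trans (Finset.sum_le_sum fun b _ => ?_)
    rw [norm_mul]
    gcongr
    exact hc₀ b
  obtain ⟨c, hc, hceq, hc1, hc2⟩ := cgo_solve hp hB hrRD (μ := fun n => -(m n)⁻¹) (δ := 1 / (τ * ω)) (K := K)
    (fun n => by
      rw [norm_neg, norm_inv, one_div]
      exact inv_anti₀ (by positivity) (hmb n).1)
    (by
      rw [div_le_iff₀ hω] at hτB
      rw [one_div, inv_mul_le_iff₀ (by positivity)]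
      linarith)
    (fun n => by
      rw [norm_neg, norm_inv, ← div_eq_mul_inv, div_le_iff₀ (hmpos n)]
      exact (hmb n).2)
  have hU := cgoU_open e ω
  refine ⟨c, hc, fun a x hx => ?_, fun a x => ?_, fun a j x => ?_⟩
  · rw [cgoL_S hpb ζ (hc a)]
    have h1 : (fun n => -(∑ j, ((cgoXi e ω n j : ℂ) ^ 2 + 2 * ζ j * (cgoXi e ω n j : ℂ))) * c a n) =
        fun n => (∑ b, cgoConv (p a b) (c b) n) + r a n := by
      funext n
      have h2 : m n ≠ 0 := norm_pos_iff.1 (hmpos n)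
      change -(m n) * c a n = _
      rw [hceq a n]
      field_simp
    rw [h1, cgoS_add (cgoRD.sum fun b => (hp a b).conv (hc b)) (hrRD a),
      cgoS_sum fun b => (hp a b).conv (hc b), cgoS_sum fun b => (hq a b).const_mul _, ← Finset.sum_add_distrib]
    refine Finset.sum_congr rfl fun b _ => ?_
    rw [cgoS_conv (cgoXi_shift e ω) (hp a b) (hc b), cgoS_const_mul, ← hp2 a b x hx]
    unfold cgoXi
    rw [← hq2 a b x hx]
    ring
  · calc τ * ‖cgoS (cgoXi e ω) (c a) x‖ ≤ τ * (2 * (1 / (τ * ω)) * (M * Q)) := by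
          gcongr
          refine (cgoS_norm_le (hc a).summable_norm x).trans ((hc1 a).trans ?_)
          gcongr
      _ = 2 / ω * (M * Q) := by field_simp
      _ ≤ _ := by
          have : 0 ≤ Kx * (2 * K * (M * Q)) := by positivity
          linarith
  · rw [cgoS_pdC hpb (hc a)]
    calc _ ≤ ∑' n, ‖cgoD (cgoXi e ω) j (c a) n‖ := cgoS_norm_le ((hc a).D hpb j).summable_norm x
      _ ≤ ∑' n, Kx * (cgoWt n * ‖c a n‖) := by
          refine ((hc a).D hpb j).summable_norm.tsum_le_tsum (fun n => ?_) (Summable.mul_left _ (by simpa using hc a 1))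
          simp only [cgoD, norm_mul, Complex.norm_I, one_mul, Complex.norm_real, Real.norm_eq_abs]
          rw [← mul_assoc]
          gcongr
          exact hKx2 n j
      _ ≤ Kx * (2 * K * (M * Q)) := by
          rw [tsum_mul_left]
          gcongr
          refine (hc2 a).trans ?_
          gcongr
      _ ≤ _ := by
          have : 0 ≤ 2 / ω * (M * Q) := by positivity
          linarith

theorem cgo_uniq_fun {e : Fin 3 → Fin 3 → ℝ} (he : cgoON e) {ω : ℝ} (hω : 0 < ω)
    {κ : ℝ} (hκ : 0 < κ) {P : (Fin 3 → ℝ) → ℂ} (hP : cgoSm P) (hPs : tsupport P ⊆ cgoU e ω) :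
    ∃ τ₀ : ℝ, ∀ τ, τ₀ ≤ τ → ∀ c : (Fin 3 → ℤ) → ℂ, cgoRD c →
        (∀ x ∈ cgoU e ω, cgoL (mxZeta τ κ (e 0) (e 1)) (cgoS (cgoXi e ω) c) x = P x * cgoS (cgoXi e ω) c x) →
        ∀ x, cgoS (cgoXi e ω) c x = 0 := by
  obtain ⟨p, hp, hp2⟩ := cgo_repr he hω 0 hP hPs
  have hpb : cgoPB (cgoXi e ω) := cgoFr_PB e ω ![1 / 2, 0, 0]
  set B := ∑' n, ‖p n‖ with hBd
  have hB0 : 0 ≤ B := tsum_nonneg fun n => norm_nonneg _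
  refine ⟨max 1 (max κ (2 * B / ω)), fun τ hτ c hc h => ?_⟩
  have hτ1 : 1 ≤ τ := (le_max_left _ _).trans hτ
  have hτκ : κ ≤ τ := ((le_max_left _ _).trans (le_max_right _ _)).trans hτ
  have hτB : 2 * B / ω ≤ τ := ((le_max_right _ _).trans (le_max_right _ _)).trans hτ
  have hτ0 : 0 < τ := by linarith
  set ζ := mxZeta τ κ (e 0) (e 1) with hζ
  set m : (Fin 3 → ℤ) → ℂ := fun n => ∑ j, ((cgoXi e ω n j : ℂ) ^ 2 + 2 * ζ j * (cgoXi e ω n j : ℂ)) with hm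
  have hmb := fun n => cgo_sym_bound he hω hτ1 hκ.le hτκ n (m := m n) rfl
  have hmpos : ∀ n, 0 < ‖m n‖ := fun n => lt_of_lt_of_le (by positivity) (hmb n).1
  have hmRD : cgoRD fun n => -(m n) * c n := by
    have h1 : ∀ j, cgoRD fun n => cgoD (cgoXi e ω) j (cgoD (cgoXi e ω) j c) n
        + 2 * Complex.I * ζ j * cgoD (cgoXi e ω) j c n := fun j =>
      ((hc.D hpb j).D hpb j).add ((hc.D hpb j).const_mul _)
    have h2 := cgoRD.sum h1
    convert h2 using 2 with n
    simp only [hm, cgoD, Fin.sum_univ_three]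
    linear_combination (-1) * (((cgoXi e ω n 0 : ℂ) ^ 2 + 2 * ζ 0 * (cgoXi e ω n 0 : ℂ) + ((cgoXi e ω n 1 : ℂ) ^ 2 + 2 * ζ 1 * (cgoXi e ω n 1 : ℂ)) +
      ((cgoXi e ω n 2 : ℂ) ^ 2 + 2 * ζ 2 * (cgoXi e ω n 2 : ℂ))) * c n * Complex.I_sq)
  have hz : ∀ n, -(m n) * c n + (-1) * cgoConv p c n = 0 := by
    refine cgo_inj he hω ![1 / 2, 0, 0] (hmRD.add ((hp.conv hc).const_mul (-1))) fun x hx => ?_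
    have h1 := h x hx
    rw [cgoL_S hpb ζ hc, hp2 x hx, ← cgoS_conv (cgoXi_shift e ω) hp hc] at h1
    rw [cgoS_add hmRD ((hp.conv hc).const_mul (-1)), cgoS_const_mul]
    change cgoS (cgoXi e ω) _ x + -1 * cgoS (cgoXi e ω) _ x = 0
    rw [← show _ = cgoS (cgoXi e ω) (cgoConv p c) x from h1]
    simp only [hm]
    ring
  have hc0 := cgo_unique hp hc (μ := fun n => -(m n)⁻¹) (δ := 1 / (τ * ω))
    (fun n => by
      rw [norm_neg, norm_inv, one_div]
      exact inv_anti₀ (by positivity) (hmb n).1)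
    (by
      rw [div_le_iff₀ hω] at hτB
      rw [one_div, inv_mul_le_iff₀ (by positivity)]
      linarith)
    (fun n => by
      have h2 : m n ≠ 0 := norm_pos_iff.1 (hmpos n)
      have h3 := hz n
      field_simp
      linear_combination (-1) * h3)
  intro x
  simp [cgoS, hc0]

theorem cgo_exp_sm (ζ : Fin 3 → ℂ) : cgoSm fun x => Complex.exp (Complex.I * ∑ j, ζ j * (x j : ℂ)) := by
  refine ContDiff.cexp (contDiff_const.mul (ContDiff.sum fun j _ => contDiff_const.mul ?_))
  exact Complex.ofRealCLM.contDiff.comp (contDiff_apply ℝ ℝ j)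

theorem cgo_exp_pd (ζ : Fin 3 → ℂ) (j : Fin 3) (x : Fin 3 → ℝ) :
    pdC (fun x => Complex.exp (Complex.I * ∑ j, ζ j * (x j : ℂ))) j x =
      Complex.I * ζ j * Complex.exp (Complex.I * ∑ j, ζ j * (x j : ℂ)) := by
  have h1 : HasFDerivAt (fun x : Fin 3 → ℝ => Complex.I * ∑ j, ζ j * (x j : ℂ))
      (∑ j, (Complex.I * ζ j) • (Complex.ofRealCLM.comp (ContinuousLinearMap.proj j : (Fin 3 → ℝ) →L[ℝ] ℝ))) x := by
    have := (∑ j, (Complex.I * ζ j) •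
      (Complex.ofRealCLM.comp (ContinuousLinearMap.proj j : (Fin 3 → ℝ) →L[ℝ] ℝ))).hasFDerivAt (x := x)
    refine this.congr_of_eventuallyEq (Filter.Eventually.of_forall fun y => ?_)
    simp [Finset.mul_sum, mul_assoc]
  unfold pdC
  rw [h1.cexp.fderiv]
  simp [Pi.single_apply, apply_ite]
  ring

theorem cgo_conj_pd {ζ : Fin 3 → ℂ} {u : (Fin 3 → ℝ) → ℂ} (hu : cgoSm u) (j : Fin 3) (x : Fin 3 → ℝ) :
    pdC (fun x => Complex.exp (Complex.I * ∑ j, ζ j * (x j : ℂ)) * u x) j x =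
      Complex.exp (Complex.I * ∑ j, ζ j * (x j : ℂ)) * (Complex.I * ζ j * u x + pdC u j x) := by
  rw [pdC_mul (cgo_exp_sm ζ) hu, cgo_exp_pd]
  ring

theorem cgo_conj_lap {ζ : Fin 3 → ℂ} {u : (Fin 3 → ℝ) → ℂ} (hu : cgoSm u) (x : Fin 3 → ℝ) :
    cgoLap (fun x => Complex.exp (Complex.I * ∑ j, ζ j * (x j : ℂ)) * u x) x =
      Complex.exp (Complex.I * ∑ j, ζ j * (x j : ℂ)) * (cgoL ζ u x - (∑ j, ζ j ^ 2) * u x) := by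
  have h1 : ∀ j, pdC (fun x => Complex.exp (Complex.I * ∑ j, ζ j * (x j : ℂ)) * u x) j =
      fun x => Complex.exp (Complex.I * ∑ j, ζ j * (x j : ℂ)) * (Complex.I * ζ j * u x + pdC u j x) :=
    fun j => funext fun x => cgo_conj_pd hu j x
  have h2 : ∀ j, pdC (fun x => Complex.exp (Complex.I * ∑ j, ζ j * (x j : ℂ)) * (Complex.I * ζ j * u x + pdC u j x)) j x =
      Complex.exp (Complex.I * ∑ j, ζ j * (x j : ℂ)) *
      (pdC (pdC u j) j x + 2 * Complex.I * ζ j * pdC u j x - ζ j ^ 2 * u x) := fun j => by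
    rw [cgo_conj_pd ((contDiff_const.mul hu).add (hu.pd j)), pdC_add (contDiff_const.mul hu) (hu.pd j),
      pdC_const_mul _ hu]
    linear_combination (Complex.exp (Complex.I * ∑ j, ζ j * (x j : ℂ)) * ζ j ^ 2 * u x) * Complex.I_sq
  unfold cgoLap
  simp only [h1, h2]
  rw [← Finset.mul_sum, Finset.sum_sub_distrib, ← Finset.sum_mul]
  rfl


theorem cgoL_const_add {ζ : Fin 3 → ℂ} {u : (Fin 3 → ℝ) → ℂ} (hu : cgoSm u) (z : ℂ) (x : Fin 3 → ℝ) :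
    cgoL ζ (fun y => z + u y) x = cgoL ζ u x := by
  unfold cgoL
  have h1 : ∀ j, pdC (fun y => z + u y) j = pdC u j := fun j => funext fun x => pdC_const_add z hu j x
  simp only [h1]

theorem cgo_zeta_sq {e : Fin 3 → Fin 3 → ℝ} (he : cgoON e) (τ κ : ℝ) :
    ∑ j, mxZeta τ κ (e 0) (e 1) j ^ 2 = (κ : ℂ) ^ 2 := by
  have h00 : ∑ k, (e 0 k : ℂ) * (e 0 k : ℂ) = 1 := by have := he 0 0; norm_cast
  have h11 : ∑ k, (e 1 k : ℂ) * (e 1 k : ℂ) = 1 := by have := he 1 1; norm_cast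
  have h01 : ∑ k, (e 0 k : ℂ) * (e 1 k : ℂ) = 0 := by have := he 0 1; norm_cast
  have hq : ((Real.sqrt (τ ^ 2 + κ ^ 2) : ℝ) : ℂ) ^ 2 = τ ^ 2 + κ ^ 2 := by
    rw [← Complex.ofReal_pow, Real.sq_sqrt (by positivity)]
    push_cast; ring
  simp only [mxZeta, Fin.sum_univ_three] at *
  linear_combination (-(τ : ℂ) ^ 2) * h00 + ((Real.sqrt (τ ^ 2 + κ ^ 2) : ℝ) : ℂ) ^ 2 * h11
    - 2 * Complex.I * τ * ((Real.sqrt (τ ^ 2 + κ ^ 2) : ℝ) : ℂ) * h01 + hq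
    + (τ : ℂ) ^ 2 * ((e 0 0 : ℂ) * e 0 0 + e 0 1 * e 0 1 + e 0 2 * e 0 2) * Complex.I_sq

theorem cgo_tsupp {K : Set (Fin 3 → ℝ)} (hK : IsClosed K) {f : (Fin 3 → ℝ) → ℂ} (h : ∀ x, x ∉ K → f x = 0) :
    tsupport f ⊆ K :=
  closure_minimal (fun x hx => by by_contra h1; exact hx (h x h1)) hK

/-- the potential matrix -/
noncomputable def cgoPm (κ : ℂ) (s si : (Fin 3 → ℝ) → ℂ) : Option (Fin 3) → Option (Fin 3) → (Fin 3 → ℝ) → ℂ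
  | some j, some l => fun x => if j = l then -κ ^ 2 * (s x ^ 2 - 1) else 0
  | some j, none => fun x => 2 * κ ^ 2 * pdC s j x
  | none, some j => fun x => -2 * pdC s j x
  | none, none => fun x => -κ ^ 2 * (s x ^ 2 - 1) + cgoLap s x * si x

theorem cgoPm_sm {κ : ℂ} {s si : (Fin 3 → ℝ) → ℂ} (hs : cgoSm s) (hsi : cgoSm si) (a b : Option (Fin 3)) :
    cgoSm (cgoPm κ s si a b) := by
  have h2 : cgoSm fun x => s x ^ 2 - 1 := (hs.pow 2).sub contDiff_const
  match a, b with
  | some j, some l =>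
    simp only [cgoPm]
    split_ifs
    · exact contDiff_const.mul h2
    · exact contDiff_const
  | some j, none => exact contDiff_const.mul (hs.pd j)
  | none, some j => exact contDiff_const.mul (hs.pd j)
  | none, none => exact (contDiff_const.mul h2).add (hs.lap.mul hsi)

theorem cgoPm_supp {κ : ℂ} {s si : (Fin 3 → ℝ) → ℂ} {K : Set (Fin 3 → ℝ)} (hK : IsClosed K)
    (h1 : ∀ x, x ∉ K → s x = 1) (a b : Option (Fin 3)) : tsupport (cgoPm κ s si a b) ⊆ K := by
  have hp : ∀ j x, x ∉ K → pdC s j x = 0 := fun j x hx => by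
    rw [pdC_congr hK.isOpen_compl (g := fun _ => 1) h1 j hx, pdC_const]
  have hl : ∀ x, x ∉ K → cgoLap s x = 0 := fun x hx => by
    unfold cgoLap
    refine Finset.sum_eq_zero fun j _ => ?_
    rw [pdC_congr hK.isOpen_compl (g := fun _ => 0) (hp j) j hx, pdC_const]
  refine cgo_tsupp hK fun x hx => ?_
  match a, b with
  | some j, some l => simp [cgoPm, h1 x hx]
  | some j, none => simp [cgoPm, hp j x hx]
  | none, some j => simp [cgoPm, hp j x hx]
  | none, none => simp [cgoPm, h1 x hx, hl x hx]

theorem cgo_core {e : Fin 3 → Fin 3 → ℝ} (he : cgoON e) {ω : ℝ} (hω : 0 < ω) {κ : ℝ} (hκ : 0 < κ)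
    {s si : (Fin 3 → ℝ) → ℂ} (hs : cgoSm s) (hsi : cgoSm si) (hssi : ∀ x, s x * si x = 1)
    {K : Set (Fin 3 → ℝ)} (hK : IsClosed K) (hKU : K ⊆ cgoU e ω) (h1 : ∀ x, x ∉ K → s x = 1)
    {M : ℝ} (hM : 0 ≤ M) :
    ∃ C τ₀ : ℝ, ∀ τ, τ₀ ≤ τ → ∀ (A0 : Fin 3 → ℂ) (f0 : ℂ), (∀ j, ‖A0 j‖ ≤ M) → ‖f0‖ ≤ M →
      ∑ j, Complex.I * mxZeta τ κ (e 0) (e 1) j * A0 j = (κ : ℂ) ^ 2 * f0 →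
      ∃ (Ar : Fin 3 → (Fin 3 → ℝ) → ℂ) (fr : (Fin 3 → ℝ) → ℂ), (∀ j, cgoSm (Ar j)) ∧ cgoSm fr ∧
        (∀ j x, τ * ‖Ar j x‖ ≤ C) ∧ (∀ x, τ * ‖fr x‖ ≤ C) ∧ (∀ j x, ‖pdC fr j x‖ ≤ C) ∧
        ∀ E : (Fin 3 → ℝ) → Fin 3 → ℂ,
          (∀ y j, E y j = Complex.exp (Complex.I * ∑ j, mxZeta τ κ (e 0) (e 1) j * (y j : ℂ)) * (A0 j + Ar j y)
            + pdC (fun y => Complex.exp (Complex.I * ∑ j, mxZeta τ κ (e 0) (e 1) j * (y j : ℂ)) * (f0 + fr y)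
              * si y) j y) →
          ∀ x ∈ cgoU e ω, ∀ i, curlC (fun y => curlC E y) x i = (κ : ℂ) ^ 2 * s x ^ 2 * E x i := by
  have hU := cgoU_open e ω
  have hpb : cgoPB (cgoXi e ω) := cgoFr_PB e ω ![1 / 2, 0, 0]
  obtain ⟨C, t1, H1⟩ := cgo_solve_fun he hω hκ (P := cgoPm κ s si) (fun a b => cgoPm_sm hs hsi a b)
    (fun a b => (cgoPm_supp hK h1 a b).trans hKU) hM
  have hs2 : cgoSm fun x => -(κ : ℂ) ^ 2 * (s x ^ 2 - 1) := contDiff_const.mul ((hs.pow 2).sub contDiff_const)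
  obtain ⟨t2, H2⟩ := cgo_uniq_fun he hω hκ hs2 ((cgo_tsupp hK fun x hx => by simp [h1 x hx]).trans hKU)
  have hs1 : cgoSm fun x => s x - 1 := hs.sub contDiff_const
  have hs1s : tsupport (fun x => s x - 1) ⊆ cgoU e ω := (cgo_tsupp hK fun x hx => by simp [h1 x hx]).trans hKU
  obtain ⟨p, hp, hp2⟩ := cgo_repr he hω 0 hs1 hs1s
  obtain ⟨q, hq, hq2⟩ := cgo_repr he hω ![1 / 2, 0, 0] hs1 hs1s
  refine ⟨C, max t1 t2, fun τ hτ A0 f0 hA0 hf0 hdiv => ?_⟩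
  set ζ := mxZeta τ κ (e 0) (e 1) with hζ
  have hζ2 : ∑ j, ζ j ^ 2 = (κ : ℂ) ^ 2 := cgo_zeta_sq he τ κ
  obtain ⟨c, hc, hceq, hcb, hcd⟩ := H1 τ ((le_max_left _ _).trans hτ)
    (fun o => match o with | some j => A0 j | none => f0)
    (fun o => match o with | some j => hA0 j | none => hf0)
  set Ar : Fin 3 → (Fin 3 → ℝ) → ℂ := fun j => cgoS (cgoXi e ω) (c (some j)) with hAr
  set fr : (Fin 3 → ℝ) → ℂ := cgoS (cgoXi e ω) (c none) with hfr
  have hArs : ∀ j, cgoSm (Ar j) := fun j => cgoS_contDiff hpb (hc _)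
  have hfrs : cgoSm fr := cgoS_contDiff hpb (hc _)
  refine ⟨Ar, fr, hArs, hfrs, fun j x => hcb (some j) x, fun x => hcb none x, fun j x => hcd none j x,
    fun E hE x hx i => ?_⟩
  set ex : (Fin 3 → ℝ) → ℂ := fun x => Complex.exp (Complex.I * ∑ j, ζ j * (x j : ℂ)) with hex
  have hexs : cgoSm ex := cgo_exp_sm ζ
  have huA : ∀ j, cgoSm fun y => A0 j + Ar j y := fun j => contDiff_const.add (hArs j)
  have huf : cgoSm fun y => f0 + fr y := contDiff_const.add hfrs
  have hAs : ∀ j, cgoSm fun y => ex y * (A0 j + Ar j y) := fun j => hexs.mul (huA j)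
  have hfs : cgoSm fun y => ex y * (f0 + fr y) := hexs.mul huf
  have eA : ∀ x ∈ cgoU e ω, ∀ j, cgoLap (fun y => ex y * (A0 j + Ar j y)) x =
      2 * (κ : ℂ) ^ 2 * (ex x * (f0 + fr x) * pdC s j x) - (κ : ℂ) ^ 2 * (s x * s x * (ex x * (A0 j + Ar j x))) := by
    intro x hx j
    rw [cgo_conj_lap (huA j), cgoL_const_add (hArs j), hζ2]
    have := hceq (some j) x hx
    rw [Fintype.sum_option] at this
    simp only [cgoPm, ite_mul, zero_mul, Finset.sum_ite_eq, Finset.mem_univ, if_true] at this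
    rw [show cgoL ζ (Ar j) x = _ from this]
    simp only [hAr, hfr, hex]
    ring
  have ef : ∀ x ∈ cgoU e ω, s x * cgoLap (fun y => ex y * (f0 + fr y)) x =
      cgoLap s x * (ex x * (f0 + fr x)) - 2 * s x * (∑ j, pdC s j x * (ex x * (A0 j + Ar j x)))
        - (κ : ℂ) ^ 2 * s x ^ 3 * (ex x * (f0 + fr x)) := by
    intro x hx
    rw [cgo_conj_lap huf, cgoL_const_add hfrs, hζ2]
    have := hceq none x hx
    rw [Fintype.sum_option] at this
    simp only [cgoPm, Fin.sum_univ_three] at this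
    rw [show cgoL ζ fr x = _ from this]
    simp only [hAr, hfr, hex, Fin.sum_univ_three]
    linear_combination (Complex.exp (Complex.I * (ζ 0 * (x 0 : ℂ) + ζ 1 * (x 1 : ℂ) + ζ 2 * (x 2 : ℂ))) * cgoLap s x *
      (f0 + cgoS (cgoXi e ω) (c none) x)) * hssi x
  set G : (Fin 3 → ℝ) → ℂ := fun y => (∑ j, (Complex.I * ζ j * Ar j y + pdC (Ar j) j y))
    - (κ : ℂ) ^ 2 * f0 * (s y - 1) - (κ : ℂ) ^ 2 * ((s y - 1) * fr y) - (κ : ℂ) ^ 2 * fr y with hG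
  have hGs : cgoSm G := by
    refine ((ContDiff.sub ?_ ?_).sub ?_).sub ?_
    · exact ContDiff.sum fun j _ => (contDiff_const.mul (hArs j)).add ((hArs j).pd j)
    · exact contDiff_const.mul hs1
    · exact contDiff_const.mul (hs1.mul hfrs)
    · exact contDiff_const.mul hfrs
  have hgG : ∀ y, (∑ j, pdC (fun y => ex y * (A0 j + Ar j y)) j y) - (κ : ℂ) ^ 2 * (s y * (ex y * (f0 + fr y)))
      = ex y * G y := by
    intro y
    have : ∀ j, pdC (fun y => ex y * (A0 j + Ar j y)) j y =
        ex y * (Complex.I * ζ j * (A0 j + Ar j y) + pdC (Ar j) j y) := fun j => by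
      rw [← pdC_const_add (A0 j) (hArs j) j y]
      exact cgo_conj_pd (huA j) j y
    simp only [this, hG]
    simp only [Fin.sum_univ_three] at hdiv ⊢
    linear_combination ex y * hdiv
  have hGL : ∀ x ∈ cgoU e ω, cgoL ζ G x = -(κ : ℂ) ^ 2 * (s x ^ 2 - 1) * G x := by
    intro x hx
    have h3 := cgo_gauge hU hs hfs hAs (κ : ℂ) eA ef hx
    rw [hgG x, show (fun y => (∑ j, pdC (fun y => ex y * (A0 j + Ar j y)) j y)
      - (κ : ℂ) ^ 2 * (s y * (ex y * (f0 + fr y)))) = fun y => ex y * G y from funext hgG, cgo_conj_lap hGs, hζ2] at h3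
    have h4 : ex x ≠ 0 := Complex.exp_ne_zero _
    refine mul_left_cancel₀ h4 ?_
    linear_combination h3
  set cG : (Fin 3 → ℤ) → ℂ := fun n => (∑ j, (Complex.I * ζ j * c (some j) n + cgoD (cgoXi e ω) j (c (some j)) n))
    + ((-(κ : ℂ) ^ 2 * f0) * q n + ((-(κ : ℂ) ^ 2) * cgoConv p (c none) n + (-(κ : ℂ) ^ 2) * c none n)) with hcG
  have k1 : ∀ j, cgoRD fun n => Complex.I * ζ j * c (some j) n + cgoD (cgoXi e ω) j (c (some j)) n := fun j =>
    ((hc _).const_mul _).add ((hc _).D hpb j)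
  have k2 : cgoRD fun n => (-(κ : ℂ) ^ 2 * f0) * q n := hq.const_mul _
  have k3 : cgoRD fun n => (-(κ : ℂ) ^ 2) * cgoConv p (c none) n := (hp.conv (hc _)).const_mul _
  have k4 : cgoRD fun n => (-(κ : ℂ) ^ 2) * c none n := (hc _).const_mul _
  have hcGr : cgoRD cG := (cgoRD.sum k1).add (k2.add (k3.add k4))
  have hGS : ∀ x ∈ cgoU e ω, G x = cgoS (cgoXi e ω) cG x := by
    intro x hx
    rw [hcG, cgoS_add (cgoRD.sum k1) (k2.add (k3.add k4)), cgoS_add k2 (k3.add k4), cgoS_add k3 k4, cgoS_sum k1]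
    simp only [fun j => cgoS_add (ξ := cgoXi e ω) ((hc (some j)).const_mul (Complex.I * ζ j)) ((hc _).D hpb j) x,
      cgoS_const_mul]
    rw [cgoS_conv (cgoXi_shift e ω) hp (hc none), ← hp2 x hx]
    have h5 : cgoS (cgoXi e ω) q x = s x - 1 := (hq2 x hx).symm
    rw [h5]
    simp only [hG, hAr, hfr, fun j => cgoS_pdC hpb (hc (some j)) j x]
    ring
  have hG0 : ∀ x ∈ cgoU e ω, G x = 0 := by
    intro x hx
    rw [hGS x hx]
    refine H2 τ ((le_max_right _ _).trans hτ) cG hcGr (fun x hx => ?_) x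
    rw [← cgoL_congr hU ζ hGS hx, ← hGS x hx]
    exact hGL x hx
  refine cgo_curlcurl hU hs hsi hssi hfs hAs (κ : ℂ) eA (fun y hy => ?_) hE hx i
  have := hgG y
  rw [hG0 y hy, mul_zero] at this
  exact sub_eq_zero.1 this


theorem cgo_frame {ρ ρp : Fin 3 → ℝ} (hρ : ∑ i, ρ i ^ 2 = 1) (hρp : ∑ i, ρp i ^ 2 = 1) (hor : ∑ i, ρ i * ρp i = 0) :
    cgoON ![ρ, ρp, ![ρ 1 * ρp 2 - ρ 2 * ρp 1, ρ 2 * ρp 0 - ρ 0 * ρp 2, ρ 0 * ρp 1 - ρ 1 * ρp 0]] := by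
  simp only [Fin.sum_univ_three] at hρ hρp hor
  intro i j
  fin_cases i <;> fin_cases j <;> simp [Fin.sum_univ_three]
  · linear_combination hρ
  · linear_combination hor
  · ring
  · linear_combination hor
  · linear_combination hρp
  · ring
  · ring
  · ring
  · linear_combination (ρp 0 ^ 2 + ρp 1 ^ 2 + ρp 2 ^ 2) * hρ + hρp
      - (ρ 0 * ρp 0 + ρ 1 * ρp 1 + ρ 2 * ρp 2) * hor

theorem cgo_cpow_sm {γ : (Fin 3 → ℝ) → ℂ} (hγ : cgoSm γ) (h : ∀ x, γ x ∈ Complex.slitPlane) (z : ℂ) :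
    cgoSm fun x => γ x ^ z := by
  have h1 : (fun x => γ x ^ z) = fun x => Complex.exp (Complex.log (γ x) * z) := by
    funext x
    rw [Complex.cpow_def_of_ne_zero (Complex.slitPlane_ne_zero (h x))]
  rw [h1]
  refine ContDiff.cexp (ContDiff.mul ?_ contDiff_const)
  rw [contDiff_iff_contDiffAt]
  intro x
  exact ((Complex.contDiffAt_log (n := (⊤ : ℕ∞)) (h x)).restrict_scalars ℝ).comp x hγ.contDiffAt

theorem cgo_unit {ρ : Fin 3 → ℝ} (hρ : ∑ i, ρ i ^ 2 = 1) (i : Fin 3) : |ρ i| ≤ 1 := by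
  have : ρ i ^ 2 ≤ 1 := by
    rw [← hρ]
    exact Finset.single_le_sum (f := fun i => ρ i ^ 2) (fun i _ => sq_nonneg _) (Finset.mem_univ i)
  exact abs_le_one_iff_mul_self_le_one.2 (by nlinarith)

theorem cgo_zeta_le {ρ ρp : Fin 3 → ℝ} (hρ : ∑ i, ρ i ^ 2 = 1) (hρp : ∑ i, ρp i ^ 2 = 1) {τ κ : ℝ} (hτ : 0 ≤ τ)
    (hκ : 0 ≤ κ) (i : Fin 3) : ‖mxZeta τ κ ρ ρp i‖ ≤ 2 * τ + κ := by
  have h1 := cgo_unit hρ i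
  have h2 := cgo_unit hρp i
  have h3 : Real.sqrt (τ ^ 2 + κ ^ 2) ≤ τ + κ := by
    rw [Real.sqrt_le_left (by positivity)]
    nlinarith [mul_nonneg hτ hκ]
  unfold mxZeta
  refine (norm_add_le _ _).trans ?_
  simp only [norm_mul, norm_neg, Complex.norm_I, Complex.norm_real, Real.norm_eq_abs, one_mul,
    abs_of_nonneg hτ, abs_of_nonneg (Real.sqrt_nonneg _)]
  have h4 : τ * |ρ i| ≤ τ * 1 := by gcongr
  have h5 : Real.sqrt (τ ^ 2 + κ ^ 2) * |ρp i| ≤ Real.sqrt (τ ^ 2 + κ ^ 2) * 1 := by gcongr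
  linarith

theorem cgo_sqrt_le {v : Fin 3 → ℂ} {B : ℝ} (hB : 0 ≤ B) (h : ∀ i, ‖v i‖ ≤ B) :
    Real.sqrt (∑ i, ‖v i‖ ^ 2) ≤ 3 * B + 1 := by
  rw [Real.sqrt_le_left (by positivity)]
  have : ∀ i, ‖v i‖ ^ 2 ≤ B ^ 2 := fun i => by have := h i; gcongr
  simp only [Fin.sum_univ_three]
  nlinarith [this 0, this 1, this 2]

theorem cgo_cross_le {v w : Fin 3 → ℂ} {N B : ℝ} (hv : ∀ i, ‖v i‖ ≤ N) (hw : ∀ i, ‖w i‖ ≤ B) (i : Fin 3) :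
    ‖crossC v w i‖ ≤ 2 * (N * B) := by
  have hN : 0 ≤ N := (norm_nonneg _).trans (hv 0)
  have key : ∀ p q r t : Fin 3, ‖v p * w q - v r * w t‖ ≤ 2 * (N * B) := fun p q r t => by
    refine (norm_sub_le _ _).trans ?_
    rw [norm_mul, norm_mul]
    have h1 : ‖v p‖ * ‖w q‖ ≤ N * B := mul_le_mul (hv p) (hw q) (norm_nonneg _) hN
    have h2 : ‖v r‖ * ‖w t‖ ≤ N * B := mul_le_mul (hv r) (hw t) (norm_nonneg _) hN
    linarith
  fin_cases i
  · exact key 1 2 2 1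
  · exact key 2 0 0 2
  · exact key 0 1 1 0

theorem cgo_eta {k κ : ℝ} (hκ : 0 < κ) {ζ : Fin 3 → ℂ} (hζ : ∑ j, ζ j ^ 2 = (κ : ℂ) ^ 2)
    (a b : Fin 3 → ℂ) :
    ∃ (A0 : Fin 3 → ℂ) (f0 : ℂ) (r : Fin 3 → ℂ), (∀ j, ‖A0 j‖ ≤ (1 + κ) * ∑ j, ‖a j‖) ∧
      ‖f0‖ ≤ (1 + κ) * ∑ j, ‖a j‖ ∧ (∑ j, Complex.I * ζ j * A0 j = (κ : ℂ) ^ 2 * f0) ∧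
      (∀ i, mxEta k κ ζ a b i = Complex.I * ζ i * f0 + r i) ∧
      ∀ i, ‖r i‖ ≤ 2 * κ * (∑ j, ‖b j‖) + k ^ 2 * (∑ j, ‖a j‖) / κ := by
  set N := Real.sqrt (∑ j, ‖ζ j‖ ^ 2) with hN
  have hs0 : 0 ≤ ∑ j, ‖ζ j‖ ^ 2 := Finset.sum_nonneg fun j _ => by positivity
  have hle : ∀ j, ‖ζ j‖ ≤ N := fun j => by
    refine Real.le_sqrt_of_sq_le ?_
    exact Finset.single_le_sum (f := fun j => ‖ζ j‖ ^ 2) (fun i _ => sq_nonneg _) (Finset.mem_univ j)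
  have hκN : κ ≤ N := by
    refine Real.le_sqrt_of_sq_le ?_
    have : ‖(κ : ℂ) ^ 2‖ ≤ ∑ j, ‖ζ j‖ ^ 2 := by
      rw [← hζ]
      refine (norm_sum_le _ _).trans_eq ?_
      simp only [norm_pow]
    simpa using this
  have hN0 : 0 < N := hκ.trans_le hκN
  have hNC : (N : ℂ) ≠ 0 := by exact_mod_cast hN0.ne'
  set Aa := ∑ j, ‖a j‖ with hAa
  have ha : ∀ j, ‖a j‖ ≤ Aa := fun j =>
    Finset.single_le_sum (f := fun j => ‖a j‖) (fun i _ => norm_nonneg _) (Finset.mem_univ j)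
  have hb : ∀ j, ‖b j‖ ≤ ∑ j, ‖b j‖ := fun j =>
    Finset.single_le_sum (f := fun j => ‖b j‖) (fun i _ => norm_nonneg _) (Finset.mem_univ j)
  have hAa0 : 0 ≤ Aa := Finset.sum_nonneg fun j _ => norm_nonneg _
  have hnN : ‖(N : ℂ)‖ = N := by rw [Complex.norm_real, Real.norm_eq_abs, abs_of_pos hN0]
  refine ⟨fun j => (κ : ℂ) ^ 2 * a j / N, Complex.I * (∑ j, ζ j * a j) / N,
    fun i => (-(κ : ℂ) * crossC ζ b i + (k : ℂ) ^ 2 * a i) / N, fun j => ?_, ?_, ?_, fun i => ?_, fun i => ?_⟩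
  · rw [norm_div, norm_mul, norm_pow, hnN, Complex.norm_real, Real.norm_eq_abs, sq_abs, div_le_iff₀ hN0]
    have h1 : κ ^ 2 * ‖a j‖ ≤ κ * N * Aa := by
      rw [pow_two]
      gcongr
      exact ha j
    have : 0 ≤ Aa * N := by positivity
    linarith
  · rw [norm_div, norm_mul, Complex.norm_I, one_mul, hnN, div_le_iff₀ hN0]
    have h1 : ‖∑ j, ζ j * a j‖ ≤ N * Aa := by
      rw [hAa, Finset.mul_sum]
      refine (norm_sum_le _ _).trans (Finset.sum_le_sum fun j _ => ?_)
      rw [norm_mul]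
      gcongr
      exact hle j
    have : 0 ≤ κ * Aa * N := by positivity
    linarith
  · simp only [Fin.sum_univ_three]
    field_simp
  · unfold mxEta
    rw [← hN]
    field_simp
    linear_combination (-(∑ j, ζ j * a j) * ζ i) * Complex.I_sq
  · rw [norm_div, hnN, div_le_iff₀ hN0]
    have h1 := cgo_cross_le hle hb i
    refine (norm_add_le _ _).trans ?_
    simp only [norm_mul, norm_neg, norm_pow, Complex.norm_real, Real.norm_eq_abs, sq_abs, abs_of_pos hκ]
    have h2 : κ * ‖crossC ζ b i‖ ≤ κ * (2 * (N * ∑ j, ‖b j‖)) := by gcongr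
    have h3 : k ^ 2 * ‖a i‖ ≤ k ^ 2 * Aa / κ * N := by
      rw [div_mul_eq_mul_div, le_div_iff₀ hκ]
      have := ha i
      gcongr
    linarith


/-- CGO solutions to the time-harmonic Maxwell system `−∇×(∇×E) + q₀E = 0` on `Ω`, with
remainder bounded in `L^∞(Ω)` uniformly in `τ`. -/
theorem maxwell_cgo_existence (n_c k : ℝ) (hnc : 0 < n_c) (hk : 0 < k)
    (κ : ℝ) (hκ : κ = k * Real.sqrt n_c)
    (n₀ σ₀ : (Fin 3 → ℝ) → ℝ)
    (hn₀ : ContDiff ℝ (⊤ : ℕ∞) n₀) (hσ₀ : ContDiff ℝ (⊤ : ℕ∞) σ₀)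
    (hn₀supp : HasCompactSupport fun x => n₀ x - n_c)
    (hσ₀supp : HasCompactSupport σ₀)
    (hn₀ge : ∀ x, n_c ≤ n₀ x) (hσ₀ge : ∀ x, 0 ≤ σ₀ x)
    (q₀ : (Fin 3 → ℝ) → ℂ)
    (hq₀ : ∀ x, q₀ x = (k : ℂ) ^ 2 * (n₀ x : ℂ) + Complex.I * (k : ℂ) * (σ₀ x : ℂ))
    (γ₀ : (Fin 3 → ℝ) → ℂ) (hγ₀ : ∀ x, γ₀ x = q₀ x / (κ : ℂ) ^ 2)
    (Ω : Set (Fin 3 → ℝ)) (hΩo : IsOpen Ω) (hΩb : Bornology.IsBounded Ω)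
    (ρ ρp : Fin 3 → ℝ)
    (hρ : ∑ i, ρ i ^ 2 = 1) (hρp : ∑ i, ρp i ^ 2 = 1) (hor : ∑ i, ρ i * ρp i = 0)
    (a b : Fin 3 → ℂ) :
    ∃ C : ℝ, 0 < C ∧ ∀ τ : ℝ, 0 < τ →
      ∃ R : (Fin 3 → ℝ) → Fin 3 → ℂ,
        ContDiffOn ℝ 2 R Ω
        ∧ (∀ x ∈ Ω, Real.sqrt (∑ i, ‖R x i‖ ^ 2) ≤ C)
        ∧ ∀ x ∈ Ω, ∀ i,
            -(curlC (fun y =>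
                curlC (mxE γ₀ (mxZeta τ κ ρ ρp) (mxEta k κ (mxZeta τ κ ρ ρp) a b) R) y) x i)
              + q₀ x * mxE γ₀ (mxZeta τ κ ρ ρp) (mxEta k κ (mxZeta τ κ ρ ρp) a b) R x i
              = 0 := by
  have hκ0 : 0 < κ := by rw [hκ]; positivity
  have hκC : (κ : ℂ) ≠ 0 := by exact_mod_cast hκ0.ne'
  have hκ2 : κ ^ 2 = k ^ 2 * n_c := by rw [hκ, mul_pow, Real.sq_sqrt hnc.le]
  have hγeq : ∀ x, γ₀ x = ((k ^ 2 * n₀ x / κ ^ 2 : ℝ) : ℂ) + ((k * σ₀ x / κ ^ 2 : ℝ) : ℂ) * Complex.I := fun x => by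
    rw [hγ₀, hq₀]; push_cast; ring
  have hγs : cgoSm γ₀ := by
    rw [show γ₀ = _ from funext hγeq]
    refine (Complex.ofRealCLM.contDiff.comp ((contDiff_const.mul hn₀).div_const _)).add
      ((Complex.ofRealCLM.contDiff.comp ((contDiff_const.mul hσ₀).div_const _)).mul contDiff_const)
  have hsl : ∀ x, γ₀ x ∈ Complex.slitPlane := fun x => by
    refine Or.inl ?_
    have h1 := hn₀ge x
    have h2 : 0 < n₀ x := by linarith
    have : (γ₀ x).re = k ^ 2 * n₀ x / κ ^ 2 := by
      rw [hγeq x]; simp only [Complex.add_re, Complex.ofReal_re, Complex.re_ofReal_mul, Complex.I_re]; ring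
    rw [this]
    positivity
  have hγ0 : ∀ x, γ₀ x ≠ 0 := fun x => Complex.slitPlane_ne_zero (hsl x)
  set s : (Fin 3 → ℝ) → ℂ := fun x => γ₀ x ^ (1 / 2 : ℂ) with hsd
  set si : (Fin 3 → ℝ) → ℂ := fun x => γ₀ x ^ (-(1 / 2) : ℂ) with hsid
  have hs : cgoSm s := cgo_cpow_sm hγs hsl _
  have hsi : cgoSm si := cgo_cpow_sm hγs hsl _
  have hssi : ∀ x, s x * si x = 1 := fun x => by
    simp only [hsd, hsid]
    rw [← Complex.cpow_add _ _ (hγ0 x)]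
    simp
  have hs2 : ∀ x, s x ^ 2 = γ₀ x := fun x => by
    simp only [hsd]
    rw [pow_two, ← Complex.cpow_add _ _ (hγ0 x)]
    norm_num
  have hq : ∀ x, q₀ x = (κ : ℂ) ^ 2 * s x ^ 2 := fun x => by
    rw [hs2, hγ₀]; field_simp
  set K : Set (Fin 3 → ℝ) := tsupport (fun x => n₀ x - n_c) ∪ tsupport σ₀ with hK
  have hKc : IsClosed K := (isClosed_tsupport _).union (isClosed_tsupport _)
  have hs1 : ∀ x, x ∉ K → s x = 1 := fun x hx => by
    have h1 : n₀ x - n_c = 0 := image_eq_zero_of_notMem_tsupport (f := fun x => n₀ x - n_c) fun h => hx (Or.inl h)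
    have h2 : σ₀ x = 0 := image_eq_zero_of_notMem_tsupport fun h => hx (Or.inr h)
    have h3 : γ₀ x = 1 := by
      rw [hγeq, h2, sub_eq_zero.1 h1, ← hκ2, div_self (by positivity)]
      simp
    simp only [hsd, h3, Complex.one_cpow]
  have hKb : Bornology.IsBounded K :=
    Bornology.IsBounded.union (IsCompact.isBounded hn₀supp) (IsCompact.isBounded hσ₀supp)
  set e : Fin 3 → Fin 3 → ℝ :=
    ![ρ, ρp, ![ρ 1 * ρp 2 - ρ 2 * ρp 1, ρ 2 * ρp 0 - ρ 0 * ρp 2, ρ 0 * ρp 1 - ρ 1 * ρp 0]] with hed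
  have he : cgoON e := cgo_frame hρ hρp hor
  obtain ⟨ω, hω, hωU⟩ := cgoU_large he (hΩb.union hKb)
  have hΩU : Ω ⊆ cgoU e ω := Set.subset_union_left.trans hωU
  have hKU : K ⊆ cgoU e ω := Set.subset_union_right.trans hωU
  set Aa := ∑ j, ‖a j‖ with hAa
  have hAa0 : 0 ≤ Aa := Finset.sum_nonneg fun j _ => norm_nonneg _
  have hBb0 : 0 ≤ ∑ j, ‖b j‖ := Finset.sum_nonneg fun j _ => norm_nonneg _
  set M := (1 + κ) * Aa with hMd
  have hM : 0 ≤ M := by positivity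
  set D := 2 * κ * (∑ j, ‖b j‖) + k ^ 2 * Aa / κ with hDd
  have hD : 0 ≤ D := by positivity
  obtain ⟨C, t0, H⟩ := cgo_core he hω hκ0 hs hsi hssi hKc hKU hs1 hM
  have hcomp : IsCompact (closure Ω) := hΩb.isCompact_closure
  obtain ⟨S1, hS1⟩ := hcomp.exists_bound_of_continuousOn (f := s) hs.continuous.continuousOn
  have hS2' : ∀ i, ∃ S2, ∀ x ∈ closure Ω, ‖s x * pdC si i x‖ ≤ S2 := fun i =>
    hcomp.exists_bound_of_continuousOn (hs.mul (hsi.pd i)).continuous.continuousOn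
  choose S2 hS2 using hS2'
  set T := max t0 (max 1 κ) with hT
  have hT0 : 0 ≤ T := le_trans zero_le_one ((le_max_left _ _).trans (le_max_right _ _))
  set S := |S1| + ∑ i, |S2 i| with hSd
  have hS20 : 0 ≤ ∑ i, |S2 i| := Finset.sum_nonneg fun i _ => abs_nonneg _
  have hS0 : 0 ≤ S := by positivity
  have hSs : ∀ x ∈ Ω, ‖s x‖ ≤ S := fun x hx => by
    have h1 := hS1 x (subset_closure hx)
    have h2 := le_abs_self S1
    linarith
  have hSp : ∀ i, ∀ x ∈ Ω, ‖s x * pdC si i x‖ ≤ S := fun i x hx => by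
    have h1 := hS2 i x (subset_closure hx)
    have h2 := le_abs_self (S2 i)
    have h3 : |S2 i| ≤ ∑ i, |S2 i| :=
      Finset.single_le_sum (f := fun i => |S2 i|) (fun i _ => abs_nonneg _) (Finset.mem_univ i)
    have h4 := abs_nonneg S1
    linarith
  set B1 := (2 * T + κ) * M + D with hB1
  set B2 := S * (M + |C|) + 3 * |C| + |C| + S * (M + |C|) + D with hB2
  have hB10 : 0 ≤ B1 := by positivity
  have hB20 : 0 ≤ B2 := by positivity
  refine ⟨3 * (B1 + B2) + 1, by positivity, fun τ hτ => ?_⟩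
  set ζ := mxZeta τ κ ρ ρp with hζd
  have hζ2 : ∑ j, ζ j ^ 2 = (κ : ℂ) ^ 2 := cgo_zeta_sq he τ κ
  obtain ⟨A0, f0, r, hA0, hf0, hdiv, hη, hr⟩ := cgo_eta (k := k) hκ0 hζ2 a b
  set η := mxEta k κ ζ a b with hηd
  have hζle : ∀ i, ‖ζ i‖ ≤ 2 * τ + κ := fun i => cgo_zeta_le hρ hρp hτ.le hκ0.le i
  rcases lt_or_ge τ T with hτT | hτT
  · refine ⟨fun _ i => -η i, contDiffOn_const, fun x hx => ?_, fun x hx i => ?_⟩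
    · refine cgo_sqrt_le (by positivity) fun i => ?_
      rw [norm_neg, hη i]
      refine (norm_add_le _ _).trans ?_
      have h1 : ‖Complex.I * ζ i * f0‖ ≤ (2 * T + κ) * M := by
        rw [norm_mul, norm_mul, Complex.norm_I, one_mul]
        exact mul_le_mul ((hζle i).trans (by linarith)) hf0 (norm_nonneg _) (by positivity)
      have := hr i
      linarith
    · have hz : mxE γ₀ ζ η (fun _ i => -η i) = fun _ _ => 0 := by
        funext y j
        simp [mxE]
      rw [hz]
      have hc : curlC (fun _ _ => (0 : ℂ)) = fun _ _ => 0 := by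
        funext y j
        fin_cases j <;> simp [curlC, pdC]
      simp only [hc]
      simp
  · have hτ1 : 1 ≤ τ := ((le_max_left _ _).trans (le_max_right _ _)).trans hτT
    have hτκ : κ ≤ τ := ((le_max_right _ _).trans (le_max_right _ _)).trans hτT
    obtain ⟨Ar, fr, hArs, hfrs, bA, bf, bd, hcc⟩ := H τ ((le_max_left _ _).trans hτT) A0 f0 hA0 hf0 hdiv
    have hCle := le_abs_self C
    have hle : ∀ z : ℂ, τ * ‖z‖ ≤ C → ‖z‖ ≤ |C| := fun z hz => by
      have : 1 * ‖z‖ ≤ τ * ‖z‖ := by gcongr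
      linarith
    refine ⟨fun x i => s x * (A0 i + Ar i x) + Complex.I * ζ i * (f0 + fr x) + pdC fr i x
      + s x * pdC si i x * (f0 + fr x) - η i, ?_, fun x hx => ?_, fun x hx i => ?_⟩
    · refine ContDiff.contDiffOn (contDiff_pi.2 fun i => ?_)
      have h1 : cgoSm fun y => f0 + fr y := contDiff_const.add hfrs
      have : cgoSm fun x => s x * (A0 i + Ar i x) + Complex.I * ζ i * (f0 + fr x) + pdC fr i x
          + s x * pdC si i x * (f0 + fr x) - η i :=
        ((((hs.mul (contDiff_const.add (hArs i))).add (contDiff_const.mul h1)).add (hfrs.pd i)).add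
          ((hs.mul (hsi.pd i)).mul h1)).sub contDiff_const
      exact contDiff_infty.1 this 2
    · refine cgo_sqrt_le (by positivity) fun i => ?_
      have h0 : s x * (A0 i + Ar i x) + Complex.I * ζ i * (f0 + fr x) + pdC fr i x
          + s x * pdC si i x * (f0 + fr x) - η i = s x * (A0 i + Ar i x) + Complex.I * ζ i * fr x + pdC fr i x
          + s x * pdC si i x * (f0 + fr x) - r i := by
        rw [hη i]; ring
      refine le_of_eq_of_le (congrArg norm h0) ?_
      have e1 : ‖s x * (A0 i + Ar i x)‖ ≤ S * (M + |C|) := by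
        rw [norm_mul]
        exact mul_le_mul (hSs x hx) ((norm_add_le _ _).trans (add_le_add (hA0 i) (hle _ (bA i x))))
          (norm_nonneg _) hS0
      have e2 : ‖Complex.I * ζ i * fr x‖ ≤ 3 * |C| := by
        rw [norm_mul, norm_mul, Complex.norm_I, one_mul]
        have h1 : ‖ζ i‖ * ‖fr x‖ ≤ 3 * τ * ‖fr x‖ := by
          have := hζle i
          gcongr
          linarith
        have := bf x
        linarith
      have e3 : ‖pdC fr i x‖ ≤ |C| := (bd i x).trans hCle
      have e4 : ‖s x * pdC si i x * (f0 + fr x)‖ ≤ S * (M + |C|) := by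
        rw [norm_mul]
        exact mul_le_mul (hSp i x hx) ((norm_add_le _ _).trans (add_le_add hf0 (hle _ (bf x))))
          (norm_nonneg _) hS0
      have e5 := hr i
      have e6 := norm_sub_le (s x * (A0 i + Ar i x) + Complex.I * ζ i * fr x + pdC fr i x
          + s x * pdC si i x * (f0 + fr x)) (r i)
      have e7 := norm_add_le (s x * (A0 i + Ar i x) + Complex.I * ζ i * fr x + pdC fr i x)
          (s x * pdC si i x * (f0 + fr x))
      have e8 := norm_add₃_le (a := s x * (A0 i + Ar i x)) (b := Complex.I * ζ i * fr x) (c := pdC fr i x)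
      linarith
    · rw [hcc _ (fun y j => ?_) x (hΩU hx) i, hq x]
      · ring
      · have hf : cgoSm fun y => f0 + fr y := contDiff_const.add hfrs
        change si y * Complex.exp (Complex.I * ∑ j, ζ j * (y j : ℂ)) * _ =
          Complex.exp (Complex.I * ∑ j, ζ j * (y j : ℂ)) * (A0 j + Ar j y)
            + pdC (fun y => Complex.exp (Complex.I * ∑ j, ζ j * (y j : ℂ)) * (f0 + fr y) * si y) j y
        rw [pdC_mul ((cgo_exp_sm ζ).mul hf) hsi, cgo_conj_pd hf, pdC_const_add f0 hfrs]
        linear_combination (Complex.exp (Complex.I * ∑ j, ζ j * (y j : ℂ)) * (A0 j + Ar j y + pdC si j y * (f0 + fr y)))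
          * hssi y
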